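/- Let 2 < q < ∞ and set α := (q−2)/(2q+2) ∈ (0, 1/2). There exist a universal constant c₁ > 0 and, for every Γ ≥ 1, a constant C' = C'(q, Γ) such that the following holds. Let n and m₀ be positive integers with √q · n^{1−α} (log n)^{(1−2α)/3} ≤ m₀ ≤ n, and let V be any finite-dimensional real normed space with cotype q constant C_q(V) ≤ Γ and with dim V ≤ c₁·m₀ / (q^{1/2} · n^{1−α} (log n)^{(1−2α)/3}). Then there exists an n-dimensional real normed space Y with C_q(Y) ≤ C' such that for every integer m with m₀ ≤ m ≤ n, every m-dimensional linear subspace Ỹ of Y contains a further subspace which is 2^{1/q}-complemented in Ỹ and 2^{1/q}-isomorphic to V. -/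

import Mathlib

open Finset

/-- The Rademacher average `2^{-M} ∑_{ε ∈ {-1,1}^M} ‖∑ i ε_i x_i‖²`. -/
noncomputable def radAvg {X : Type*} [SeminormedAddCommGroup X] [NormedSpace ℝ X]
    {M : ℕ} (x : Fin M → X) : ℝ :=
  ((2:ℝ)^M)⁻¹ * ∑ ε : Fin M → Bool, ‖∑ i, (if ε i then (1:ℝ) else -1) • x i‖^2

/-- The cotype-`q` constant `C_q(X)` (for `2 ≤ q < ∞`): the smallest `C ≥ 0` such that for
every finite sequence `x_1, …, x_M` in `X` one has
`(∑ ‖x_i‖^q)^{1/q} ≤ C (2^{-M} ∑_ε ‖∑ ε_i x_i‖²)^{1/2}`. -/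
noncomputable def cotypeConst (q : ℝ) (X : Type*) [SeminormedAddCommGroup X]
    [NormedSpace ℝ X] : ℝ :=
  sInf {C : ℝ | 0 ≤ C ∧ ∀ (M : ℕ) (x : Fin M → X),
    (∑ i, ‖x i‖ ^ q) ^ (1 / q) ≤ C * Real.sqrt (radAvg x)}

/-- The subspace `E` of `Y` is `C`-isomorphic to `V`: there is a linear bijection
`T : V → E` with `‖T‖ ⬝ ‖T⁻¹‖ ≤ C`, i.e. `r ‖v‖ ≤ ‖T v‖ ≤ C r ‖v‖` for some `r > 0`. -/
def IsomorphicTo (C : ℝ) (V : Type*) [SeminormedAddCommGroup V] [NormedSpace ℝ V]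
    {Y : Type*} [SeminormedAddCommGroup Y] [NormedSpace ℝ Y] (E : Submodule ℝ Y) : Prop :=
  ∃ (T : V ≃ₗ[ℝ] E) (r : ℝ), 0 < r ∧
    ∀ v : V, r * ‖v‖ ≤ ‖(T v : Y)‖ ∧ ‖(T v : Y)‖ ≤ C * (r * ‖v‖)

/-- The subspace `E` is `C`-complemented in `Y`: there is a linear projection of `Y`
onto `E` of norm at most `C`. -/
def ComplementedIn (C : ℝ) {Y : Type*} [SeminormedAddCommGroup Y] [NormedSpace ℝ Y]
    (E : Submodule ℝ Y) : Prop :=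
  ∃ P : Y →ₗ[ℝ] Y, P ∘ₗ P = P ∧ LinearMap.range P = E ∧ ∀ y, ‖P y‖ ≤ C * ‖y‖

open scoped BigOperators

namespace Saturation

/-- The vector of signs `±1` encoded by a Boolean vector. -/
def signVec {I : Type*} (ε : I → Bool) : I → ℝ := fun i => if ε i then (1 : ℝ) else -1

theorem two_point_aux {a b u v : ℝ} (hab : b ≤ a)
    (hu : ∀ θ : ℝ, 0 ≤ θ → θ ≤ 1 → u ≤ Real.exp (θ ^ 2 / 2 + (1 - θ) * a + θ * b))
    (hv : v ≤ Real.exp b) :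
    (u + v) * (Real.exp (-a) + Real.exp (-b)) ≤ 4 := by
  obtain ⟨d, rfl⟩ : ∃ d, a = b + d := ⟨a - b, by ring⟩
  have hd : 0 ≤ d := by linarith
  have reduce : ∀ c : ℝ, u ≤ Real.exp (b + c) →
      (u + v) * (Real.exp (-(b + d)) + Real.exp (-b)) ≤
        (Real.exp c + 1) * (Real.exp (-d) + 1) := by
    intro c hc
    calc (u + v) * (Real.exp (-(b + d)) + Real.exp (-b))
        ≤ (Real.exp (b + c) + Real.exp b) * (Real.exp (-(b + d)) + Real.exp (-b)) := by
          gcongr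
      _ = (Real.exp b * Real.exp (-b)) * ((Real.exp c + 1) * (Real.exp (-d) + 1)) := by
          rw [neg_add, Real.exp_add, Real.exp_add]; ring
      _ = _ := by rw [← Real.exp_add]; simp
  rcases le_total d 1 with h1 | h1
  · set c := d - d ^ 2 / 2 with hc
    have hc0 : 0 ≤ c := by nlinarith
    have hcd : c ≤ d := by nlinarith
    refine (reduce c ?_).trans ?_
    · refine (hu d hd h1).trans (Real.exp_le_exp.2 ?_)
      rw [hc]; nlinarith
    · have key : (Real.exp c + 1) * (Real.exp (-d) + 1)
          = 4 * (Real.exp ((c - d) / 2) * Real.cosh (c / 2) * Real.cosh (d / 2)) := by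
        rw [Real.cosh_eq, Real.cosh_eq]
        have e1 : Real.exp c = Real.exp (c / 2) ^ 2 := by
          rw [← Real.exp_nat_mul]; congr 1; push_cast; ring
        have e2 : Real.exp (-d) = Real.exp (-(d / 2)) ^ 2 := by
          rw [← Real.exp_nat_mul]; congr 1; push_cast; ring
        have e3 : Real.exp ((c - d) / 2) = Real.exp (c / 2) * Real.exp (-(d / 2)) := by
          rw [← Real.exp_add]; congr 1; ring
        have e4 : Real.exp (c / 2) * Real.exp (-(c / 2)) = 1 := by rw [← Real.exp_add]; simp
        have e5 : Real.exp (d / 2) * Real.exp (-(d / 2)) = 1 := by rw [← Real.exp_add]; simp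
        rw [e1, e2, e3]
        linear_combination (- (Real.exp (-(d / 2)) ^ 2 + 1)) * e4 -
          (Real.exp (c / 2) * (Real.exp (c / 2) + Real.exp (-(c / 2)))) * e5
      rw [key]
      have h2 : Real.exp ((c - d) / 2) * Real.cosh (c / 2) * Real.cosh (d / 2) ≤ 1 := by
        calc _ ≤ Real.exp ((c - d) / 2) * Real.exp ((c / 2) ^ 2 / 2) *
              Real.exp ((d / 2) ^ 2 / 2) := by
              have := Real.cosh_pos (d / 2)
              gcongr
              · exact Real.cosh_le_exp_half_sq _
              · exact Real.cosh_le_exp_half_sq _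
          _ = Real.exp ((c - d) / 2 + (c / 2) ^ 2 / 2 + (d / 2) ^ 2 / 2) := by
              rw [Real.exp_add, Real.exp_add]
          _ ≤ 1 := by
              rw [Real.exp_le_one_iff]
              have : c ^ 2 ≤ d ^ 2 := by gcongr
              have h3 : c - d = - (d ^ 2 / 2) := by rw [hc]; ring
              rw [h3]; nlinarith
      linarith
  · refine (reduce (1 / 2) ?_).trans ?_
    · refine (hu 1 zero_le_one le_rfl).trans (Real.exp_le_exp.2 ?_)
      linarith
    · have h3 : Real.exp (1 / 2) ≤ 1.65 := by
        have : Real.exp (1 / 2) ^ 2 = Real.exp 1 := by rw [← Real.exp_nat_mul]; norm_num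
        have h4 := Real.exp_one_lt_d9
        have := Real.exp_pos (1 / 2)
        nlinarith
      have h5 : Real.exp (-d) ≤ 0.37 := by
        have h6 : Real.exp (-d) ≤ Real.exp (-1) := Real.exp_le_exp.2 (by linarith)
        have h7 : Real.exp (-1) * Real.exp 1 = 1 := by rw [← Real.exp_add]; simp
        have := Real.exp_one_gt_d9
        have := Real.exp_pos (-1)
        nlinarith
      have := Real.exp_pos (-d)
      have := Real.exp_pos (1 / 2)
      nlinarith

theorem two_point {a b u v : ℝ}
    (hu : ∀ θ : ℝ, 0 ≤ θ → θ ≤ 1 → u ≤ Real.exp (θ ^ 2 / 2 + (1 - θ) * a + θ * b))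
    (hv : ∀ θ : ℝ, 0 ≤ θ → θ ≤ 1 → v ≤ Real.exp (θ ^ 2 / 2 + (1 - θ) * b + θ * a)) :
    (u + v) * (Real.exp (-a) + Real.exp (-b)) ≤ 4 := by
  rcases le_total b a with h | h
  · refine two_point_aux h hu ?_
    simpa using hv 0 le_rfl zero_le_one
  · rw [add_comm u, add_comm (Real.exp _)]
    refine two_point_aux h hv ?_
    simpa using hu 0 le_rfl zero_le_one

/-- The infimal convolution of `f` with the quadratic cost `|x - y|² / 8`. -/
noncomputable def infConv {I : Type*} [Fintype I] (f : (I → ℝ) → ℝ) (x : I → ℝ) : ℝ :=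
  ⨅ y : I → ℝ, (f y + (∑ i, (x i - y i) ^ 2) / 8)

theorem infConv_le {I : Type*} [Fintype I] {f : (I → ℝ) → ℝ} (hf : ∀ y, 0 ≤ f y)
    (x y : I → ℝ) : infConv f x ≤ f y + (∑ i, (x i - y i) ^ 2) / 8 := by
  refine ciInf_le ⟨0, ?_⟩ y
  rintro _ ⟨z, rfl⟩
  have := hf z
  have : 0 ≤ ∑ i, (x i - z i) ^ 2 := sum_nonneg fun i _ => sq_nonneg _
  show 0 ≤ f z + (∑ i, (x i - z i) ^ 2) / 8
  linarith

theorem expect_cons {n : ℕ} (h : (Fin (n + 1) → Bool) → ℝ) :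
    𝔼 ε, h ε = (𝔼 ε : Fin n → Bool, h (Fin.cons true ε) +
      𝔼 ε : Fin n → Bool, h (Fin.cons false ε)) / 2 := by
  have : ∑ ε, h ε = ∑ ε : Fin n → Bool, h (Fin.cons true ε) +
      ∑ ε : Fin n → Bool, h (Fin.cons false ε) := by
    rw [← (Fin.consEquiv (fun _ : Fin (n + 1) => Bool)).sum_comp, Fintype.sum_prod_type,
      Fintype.sum_bool]
    rfl
  simp only [Fintype.expect_eq_sum_div_card, this, Fintype.card_fun, Fintype.card_bool,
    Fintype.card_fin]
  push_cast
  field_simp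
  ring

theorem expect_exp_convexComb_le {Ω : Type*} [Fintype Ω] [Nonempty Ω] (g h : Ω → ℝ) {θ a b : ℝ}
    (hθ0 : 0 ≤ θ) (hθ1 : θ ≤ 1) (ha : 𝔼 ω, Real.exp (g ω) ≤ Real.exp a)
    (hb : 𝔼 ω, Real.exp (h ω) ≤ Real.exp b) :
    𝔼 ω, Real.exp ((1 - θ) * g ω + θ * h ω) ≤ Real.exp ((1 - θ) * a + θ * b) := by
  have pt : ∀ ω, Real.exp ((1 - θ) * g ω + θ * h ω) ≤
      Real.exp ((1 - θ) * a + θ * b) *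
        ((1 - θ) * (Real.exp (-a) * Real.exp (g ω)) + θ * (Real.exp (-b) * Real.exp (h ω))) := by
    intro ω
    have hc := convexOn_exp.2 (Set.mem_univ (-a + g ω)) (Set.mem_univ (-b + h ω))
      (sub_nonneg.2 hθ1) hθ0 (by ring)
    simp only [smul_eq_mul] at hc
    rw [← Real.exp_add, ← Real.exp_add]
    refine le_trans (le_of_eq ?_) (mul_le_mul_of_nonneg_left hc (Real.exp_pos _).le)
    rw [← Real.exp_add]; congr 1; ring
  refine (expect_le_expect fun ω _ => pt ω).trans ?_
  rw [← mul_expect, expect_add_distrib, ← mul_expect, ← mul_expect, ← mul_expect, ← mul_expect]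
  have h1 : Real.exp (-a) * 𝔼 ω, Real.exp (g ω) ≤ 1 := by
    calc _ ≤ Real.exp (-a) * Real.exp a := by gcongr
      _ = 1 := by rw [← Real.exp_add]; simp
  have h2 : Real.exp (-b) * 𝔼 ω, Real.exp (h ω) ≤ 1 := by
    calc _ ≤ Real.exp (-b) * Real.exp b := by gcongr
      _ = 1 := by rw [← Real.exp_add]; simp
  have : (1 - θ) * (Real.exp (-a) * 𝔼 ω, Real.exp (g ω)) +
      θ * (Real.exp (-b) * 𝔼 ω, Real.exp (h ω)) ≤ 1 := by nlinarith
  calc _ ≤ Real.exp ((1 - θ) * a + θ * b) * 1 := by gcongr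
    _ = _ := mul_one _

theorem convexOn_section {n : ℕ} {f : (Fin (n + 1) → ℝ) → ℝ} (hf : ConvexOn ℝ Set.univ f) (s : ℝ) :
    ConvexOn ℝ Set.univ (fun y : Fin n → ℝ => f (Fin.cons s y)) := by
  refine ⟨convex_univ, fun x _ y _ a b ha hb hab => ?_⟩
  convert hf.2 (Set.mem_univ (Fin.cons s x : Fin (n+1) → ℝ))
    (Set.mem_univ (Fin.cons s y : Fin (n+1) → ℝ)) ha hb hab using 2
  ext i
  refine Fin.cases ?_ (fun i => ?_) i
  · simp [← add_mul, hab]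
  · simp

theorem infConv_cons_le {n : ℕ} {f : (Fin (n + 1) → ℝ) → ℝ} (hf : ConvexOn ℝ Set.univ f)
    (h0 : ∀ y, 0 ≤ f y) (x : Fin n → ℝ) {s t θ : ℝ} (hst : (s - t) ^ 2 ≤ 4) (hθ0 : 0 ≤ θ)
    (hθ1 : θ ≤ 1) :
    infConv f (Fin.cons s x) ≤ θ ^ 2 / 2 +
      ((1 - θ) * infConv (fun y => f (Fin.cons s y)) x +
        θ * infConv (fun y => f (Fin.cons t y)) x) := by
  have pt : ∀ y z : Fin n → ℝ, infConv f (Fin.cons s x) ≤ θ ^ 2 / 2 +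
      ((1 - θ) * (f (Fin.cons s y) + (∑ i, (x i - y i) ^ 2) / 8) +
        θ * (f (Fin.cons t z) + (∑ i, (x i - z i) ^ 2) / 8)) := by
    intro y z
    refine (infConv_le h0 _
      ((1 - θ) • (Fin.cons s y : Fin (n + 1) → ℝ) + θ • Fin.cons t z)).trans ?_
    have hc := hf.2 (Set.mem_univ (Fin.cons s y : Fin (n+1) → ℝ))
      (Set.mem_univ (Fin.cons t z : Fin (n+1) → ℝ))
      (sub_nonneg.2 hθ1) hθ0 (by ring)
    simp only [smul_eq_mul] at hc
    have hs : ∑ i : Fin (n + 1), ((Fin.cons s x : Fin (n + 1) → ℝ) i -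
        ((1 - θ) • (Fin.cons s y : Fin (n + 1) → ℝ) + θ • (Fin.cons t z : Fin (n + 1) → ℝ)) i) ^ 2 ≤
        θ ^ 2 * 4 + ((1 - θ) * ∑ i, (x i - y i) ^ 2 + θ * ∑ i, (x i - z i) ^ 2) := by
      rw [Fin.sum_univ_succ]
      refine add_le_add ?_ ?_
      · simp only [Fin.cons_zero, Pi.add_apply, Pi.smul_apply, smul_eq_mul]
        nlinarith [sq_nonneg θ]
      · rw [mul_sum, mul_sum, ← sum_add_distrib]
        refine sum_le_sum fun i _ => ?_
        simp only [Fin.cons_succ, Pi.add_apply, Pi.smul_apply, smul_eq_mul]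
        nlinarith [mul_nonneg (mul_nonneg hθ0 (sub_nonneg.2 hθ1)) (sq_nonneg (y i - z i))]
    linarith
  have mulInf : ∀ (c : ℝ) (φ : (Fin n → ℝ) → ℝ) (A : ℝ), 0 ≤ c → (∀ y, A ≤ c * φ y) →
      A ≤ c * ⨅ y, φ y := by
    intro c φ A hc h
    rw [Real.mul_iInf_of_nonneg hc]
    exact le_ciInf h
  have step : ∀ y : Fin n → ℝ, infConv f (Fin.cons s x) - θ ^ 2 / 2 -
      (1 - θ) * (f (Fin.cons s y) + (∑ i, (x i - y i) ^ 2) / 8) ≤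
      θ * infConv (fun y => f (Fin.cons t y)) x := fun y =>
    mulInf _ _ _ hθ0 fun z => by have := pt y z; linarith
  have step2 : infConv f (Fin.cons s x) - θ ^ 2 / 2 - θ * infConv (fun y => f (Fin.cons t y)) x ≤
      (1 - θ) * infConv (fun y => f (Fin.cons s y)) x :=
    mulInf _ _ _ (sub_nonneg.2 hθ1) fun y => by have := step y; linarith
  linarith

theorem signVec_cons {n : ℕ} (b : Bool) (ε : Fin n → Bool) :
    signVec (Fin.cons b ε : Fin (n + 1) → Bool) =
      Fin.cons (if b then (1 : ℝ) else -1) (signVec ε) := by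
  ext i
  refine Fin.cases ?_ (fun i => ?_) i <;> simp [signVec]

/-- Maurey's convex infimum-convolution inequality for the uniform measure on the cube. -/
theorem convex_property_tau_fin (n : ℕ) : ∀ f : (Fin n → ℝ) → ℝ, ConvexOn ℝ Set.univ f →
    (∀ y, 0 ≤ f y) →
    (𝔼 ε : Fin n → Bool, Real.exp (infConv f (signVec ε))) *
      𝔼 ε : Fin n → Bool, Real.exp (-f (signVec ε)) ≤ 1 := by
  induction n with
  | zero =>
    intro f _ h0
    have e : ∀ ε : Fin 0 → Bool, signVec ε = 0 := fun _ => Subsingleton.elim _ _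
    simp only [e, Fintype.expect_const]
    rw [← Real.exp_add, Real.exp_le_one_iff]
    have := infConv_le h0 0 0
    simp only [univ_eq_empty, sum_empty, zero_div, add_zero] at this
    linarith
  | succ n ih =>
    intro f hf h0
    have pos : ∀ s : ℝ, 0 < 𝔼 ε : Fin n → Bool, Real.exp (-f (Fin.cons s (signVec ε))) := fun s =>
      expect_pos (fun _ _ => Real.exp_pos _) univ_nonempty
    have hA : ∀ s : ℝ,
        𝔼 ε : Fin n → Bool, Real.exp (infConv (fun y => f (Fin.cons s y)) (signVec ε)) ≤
        Real.exp (-Real.log (𝔼 ε : Fin n → Bool, Real.exp (-f (Fin.cons s (signVec ε))))) := by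
      intro s
      rw [Real.exp_neg, Real.exp_log (pos s), ← one_div, le_div_iff₀ (pos s)]
      exact ih _ (convexOn_section hf s) fun y => h0 _
    have hB : ∀ s t : ℝ, (s - t) ^ 2 ≤ 4 → ∀ θ : ℝ, 0 ≤ θ → θ ≤ 1 →
        𝔼 ε : Fin n → Bool, Real.exp (infConv f (Fin.cons s (signVec ε))) ≤
        Real.exp (θ ^ 2 / 2 + (1 - θ) *
          (-Real.log (𝔼 ε : Fin n → Bool, Real.exp (-f (Fin.cons s (signVec ε))))) + θ *
          (-Real.log (𝔼 ε : Fin n → Bool, Real.exp (-f (Fin.cons t (signVec ε)))))) := by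
      intro s t hst θ h1 h2
      refine (expect_le_expect fun ε _ => Real.exp_le_exp.2
        (infConv_cons_le hf h0 (signVec ε) hst h1 h2)).trans ?_
      simp only [Real.exp_add (θ ^ 2 / 2), ← mul_expect, add_assoc (θ ^ 2 / 2)]
      gcongr
      exact expect_exp_convexComb_le _ _ h1 h2 (hA s) (hA t)
    have := two_point (hB 1 (-1) (by norm_num)) (hB (-1) 1 (by norm_num))
    rw [neg_neg, neg_neg, Real.exp_log (pos _), Real.exp_log (pos _)] at this
    rw [expect_cons, expect_cons]
    simp only [signVec_cons, if_true, Bool.false_eq_true, if_false]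
    linarith

section Concentration

variable {I : Type*} [Fintype I] [DecidableEq I] (F : Seminorm ℝ (I → ℝ)) {σ : ℝ}

/-- Concentration of a Lipschitz seminorm on the cube, in product form. -/
theorem expect_exp_mul_expect_exp_neg_le (hσ : ∀ t, F t ≤ σ * √(∑ i, t i ^ 2)) {l : ℝ}
    (hl : 0 ≤ l) :
    (𝔼 ε : I → Bool, Real.exp (l * F (signVec ε))) *
      𝔼 ε : I → Bool, Real.exp (-(l * F (signVec ε))) ≤ Real.exp (2 * l ^ 2 * σ ^ 2) := by
  let e := Fintype.equivFin I
  let f : (Fin (Fintype.card I) → ℝ) → ℝ := fun y => l * F (y ∘ e)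
  have hf : ConvexOn ℝ Set.univ f := by
    refine ⟨convex_univ, fun x _ y _ a b ha hb _ => ?_⟩
    have h1 : F ((a • x + b • y) ∘ e) ≤ a * F (x ∘ e) + b * F (y ∘ e) := by
      have : (a • x + b • y) ∘ e = a • (x ∘ e) + b • (y ∘ e) := rfl
      rw [this]
      refine (map_add_le_add F _ _).trans ?_
      rw [map_smul_eq_mul, map_smul_eq_mul, Real.norm_of_nonneg ha, Real.norm_of_nonneg hb]
    simp only [f, smul_eq_mul]
    nlinarith
  have h0 : ∀ y, 0 ≤ f y := fun y => mul_nonneg hl (apply_nonneg F _)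
  have hq : ∀ x, f x - 2 * l ^ 2 * σ ^ 2 ≤ infConv f x := by
    intro x
    refine le_ciInf fun y => ?_
    have h1 : F (x ∘ e) ≤ F (y ∘ e) + σ * √(∑ i, (x i - y i) ^ 2) := by
      have h2 := hσ (x ∘ e - y ∘ e)
      have h3 : ∑ i, (x ∘ e - y ∘ e) i ^ 2 = ∑ i, (x i - y i) ^ 2 :=
        e.sum_comp fun i => (x i - y i) ^ 2
      rw [h3] at h2
      have h4 := map_add_le_add F (x ∘ e - y ∘ e) (y ∘ e)
      rw [sub_add_cancel] at h4
      linarith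
    have h5 : √(∑ i, (x i - y i) ^ 2) ^ 2 = ∑ i, (x i - y i) ^ 2 :=
      Real.sq_sqrt (sum_nonneg fun i _ => sq_nonneg _)
    rw [← h5]
    simp only [f]
    nlinarith [sq_nonneg (√(∑ i, (x i - y i) ^ 2) / 4 - l * σ), mul_le_mul_of_nonneg_left h1 hl]
  have main := convex_property_tau_fin _ f hf h0
  have t1 : ∀ h : ℝ → ℝ, 𝔼 ε : I → Bool, h (F (signVec ε)) =
      𝔼 ε : Fin (Fintype.card I) → Bool, h (F (signVec ε ∘ e)) := by
    intro h
    refine (Fintype.expect_equiv (Equiv.arrowCongr e (Equiv.refl Bool)) _ _ fun ε => ?_)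
    congr 2
    ext i
    simp [signVec, Equiv.arrowCongr]
  rw [t1 fun z => Real.exp (l * z), t1 fun z => Real.exp (-(l * z))]
  have h6 : 𝔼 ε : Fin (Fintype.card I) → Bool, Real.exp (l * F (signVec ε ∘ e)) ≤
      Real.exp (2 * l ^ 2 * σ ^ 2) *
        𝔼 ε : Fin (Fintype.card I) → Bool, Real.exp (infConv f (signVec ε)) := by
    rw [mul_expect]
    refine expect_le_expect fun ε _ => ?_
    rw [← Real.exp_add, Real.exp_le_exp]
    have := hq (signVec ε)
    simp only [f] at this
    linarith
  have h7 : 0 ≤ 𝔼 ε : Fin (Fintype.card I) → Bool, Real.exp (-(l * F (signVec ε ∘ e))) :=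
    expect_nonneg fun _ _ => (Real.exp_pos _).le
  calc _ ≤ (Real.exp (2 * l ^ 2 * σ ^ 2) *
        𝔼 ε : Fin (Fintype.card I) → Bool, Real.exp (infConv f (signVec ε))) *
        𝔼 ε : Fin (Fintype.card I) → Bool, Real.exp (-(l * F (signVec ε ∘ e))) := by gcongr
    _ ≤ Real.exp (2 * l ^ 2 * σ ^ 2) * 1 := by
        rw [mul_assoc]
        gcongr
    _ = _ := mul_one _

theorem exp_expect_le {Ω : Type*} [Fintype Ω] [Nonempty Ω] (g : Ω → ℝ) :
    Real.exp (𝔼 ω, g ω) ≤ 𝔼 ω, Real.exp (g ω) := by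
  have pt : ∀ ω, Real.exp (𝔼 ω, g ω) * (1 + (g ω - 𝔼 ω, g ω)) ≤ Real.exp (g ω) := by
    intro ω
    have h := Real.add_one_le_exp (g ω - 𝔼 ω, g ω)
    calc _ ≤ Real.exp (𝔼 ω, g ω) * Real.exp (g ω - 𝔼 ω, g ω) := by
          gcongr
          linarith
      _ = _ := by rw [← Real.exp_add]; congr 1; ring
  refine le_trans (le_of_eq ?_) (expect_le_expect fun ω _ => pt ω)
  rw [← mul_expect, expect_add_distrib, expect_sub_distrib, Fintype.expect_const,
    Fintype.expect_const]
  ring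

theorem expect_exp_le (hσ : ∀ t, F t ≤ σ * √(∑ i, t i ^ 2)) {l : ℝ} (hl : 0 ≤ l) :
    𝔼 ε : I → Bool, Real.exp (l * F (signVec ε)) ≤
      Real.exp (l * (𝔼 ε : I → Bool, F (signVec ε)) + 2 * l ^ 2 * σ ^ 2) := by
  have h := expect_exp_mul_expect_exp_neg_le F hσ hl
  have h2 := exp_expect_le fun ε : I → Bool => -(l * F (signVec ε))
  rw [expect_neg_distrib, ← mul_expect] at h2
  have h3 : 0 ≤ 𝔼 ε : I → Bool, Real.exp (l * F (signVec ε)) :=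
    expect_nonneg fun _ _ => (Real.exp_pos _).le
  have h4 := (mul_le_mul_of_nonneg_left h2 h3).trans h
  rwa [Real.exp_neg, ← div_eq_mul_inv, div_le_iff₀ (Real.exp_pos _), ← Real.exp_add,
    add_comm] at h4

theorem expect_exp_neg_le (hσ : ∀ t, F t ≤ σ * √(∑ i, t i ^ 2)) {l : ℝ} (hl : 0 ≤ l) :
    𝔼 ε : I → Bool, Real.exp (-(l * F (signVec ε))) ≤
      Real.exp (-(l * 𝔼 ε : I → Bool, F (signVec ε)) + 2 * l ^ 2 * σ ^ 2) := by
  have h := expect_exp_mul_expect_exp_neg_le F hσ hl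
  have h2 := exp_expect_le fun ε : I → Bool => (l * F (signVec ε))
  rw [← mul_expect] at h2
  have h3 : 0 ≤ 𝔼 ε : I → Bool, Real.exp (-(l * F (signVec ε))) :=
    expect_nonneg fun _ _ => (Real.exp_pos _).le
  have h4 := (mul_le_mul_of_nonneg_right h2 h3).trans h
  rw [mul_comm, ← le_div_iff₀ (Real.exp_pos _), ← Real.exp_sub] at h4
  refine h4.trans (Real.exp_le_exp.2 (by linarith))

/-- The uniform probability of an event on a finite type. -/
noncomputable def Pr {Ω : Type*} [Fintype Ω] (s : Set Ω) : ℝ := 𝔼 ω, s.indicator 1 ω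

theorem Pr_le_expect {Ω : Type*} [Fintype Ω] {s : Set Ω} {h : Ω → ℝ} (h0 : ∀ ω, 0 ≤ h ω)
    (h1 : ∀ ω ∈ s, 1 ≤ h ω) : Pr s ≤ 𝔼 ω, h ω :=
  expect_le_expect fun ω _ => by
    by_cases hω : ω ∈ s
    · simpa [hω] using h1 ω hω
    · simpa [hω] using h0 ω

theorem Pr_mono {Ω : Type*} [Fintype Ω] {s t : Set Ω} (h : s ⊆ t) : Pr s ≤ Pr t :=
  expect_le_expect fun _ _ =>
    Set.indicator_le_indicator_of_subset h (fun _ => zero_le_one) _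

theorem Pr_iUnion_le {Ω ι : Type*} [Fintype Ω] (T : Finset ι) (s : ι → Set Ω) :
    Pr (⋃ i ∈ T, s i) ≤ ∑ i ∈ T, Pr (s i) := by
  unfold Pr
  rw [← expect_sum_comm]
  refine expect_le_expect fun ω _ => ?_
  by_cases hω : ω ∈ ⋃ i ∈ T, s i
  · obtain ⟨i, hi, hs⟩ : ∃ i ∈ T, ω ∈ s i := by simpa using hω
    have h1 : (s i).indicator (1 : Ω → ℝ) ω ≤ ∑ i ∈ T, (s i).indicator (1 : Ω → ℝ) ω :=
      single_le_sum (f := fun i => (s i).indicator (1 : Ω → ℝ) ω)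
        (fun _ _ => Set.indicator_nonneg (fun _ _ => zero_le_one) _) hi
    simpa [hω, hs] using h1
  · rw [Set.indicator_of_notMem hω]
    exact sum_nonneg fun _ _ => Set.indicator_nonneg (fun _ _ => zero_le_one) _

theorem Pr_union_le {Ω : Type*} [Fintype Ω] (s t : Set Ω) : Pr (s ∪ t) ≤ Pr s + Pr t := by
  unfold Pr
  rw [← expect_add_distrib]
  refine expect_le_expect fun ω _ => ?_
  by_cases h1 : ω ∈ s <;> by_cases h2 : ω ∈ t <;> simp [h1, h2]

theorem exists_notMem_of_Pr_lt_one {Ω : Type*} [Fintype Ω] [Nonempty Ω] {s : Set Ω}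
    (h : Pr s < 1) : ∃ ω, ω ∉ s := by
  by_contra! hs
  have : Pr s = 1 := by
    unfold Pr
    rw [expect_congr rfl (g := fun _ => (1 : ℝ)) fun ω _ => by simp [hs ω]]
    exact Fintype.expect_const 1
  linarith

theorem Pr_upper_tail (hσ : ∀ t, F t ≤ σ * √(∑ i, t i ^ 2)) (hσ0 : 0 < σ) {μ s : ℝ} (hs : 0 ≤ s)
    (hμ : 𝔼 ε : I → Bool, F (signVec ε) ≤ μ) :
    Pr {ε : I → Bool | μ + s < F (signVec ε)} ≤ Real.exp (-(s ^ 2 / (8 * σ ^ 2))) := by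
  set l := s / (4 * σ ^ 2) with hl
  have hl0 : 0 ≤ l := by positivity
  have h1 := expect_exp_le F hσ hl0
  have h2 : Pr {ε : I → Bool | μ + s < F (signVec ε)} ≤
      𝔼 ε : I → Bool, Real.exp (-(l * (μ + s))) * Real.exp (l * F (signVec ε)) := by
    refine Pr_le_expect (fun _ => by positivity) fun ε hε => ?_
    rw [← Real.exp_add, Real.one_le_exp_iff]
    have : l * (μ + s) ≤ l * F (signVec ε) := mul_le_mul_of_nonneg_left (le_of_lt hε) hl0
    linarith
  rw [← mul_expect] at h2
  refine h2.trans ((mul_le_mul_of_nonneg_left h1 (Real.exp_pos _).le).trans ?_)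
  rw [← Real.exp_add, Real.exp_le_exp]
  have h3 := mul_le_mul_of_nonneg_left hμ hl0
  have h4 : - (l * s) + 2 * l ^ 2 * σ ^ 2 = -(s ^ 2 / (8 * σ ^ 2)) := by
    rw [hl]; field_simp; ring
  linarith

theorem Pr_lower_tail (hσ : ∀ t, F t ≤ σ * √(∑ i, t i ^ 2)) (hσ0 : 0 < σ) {μ s : ℝ} (hs : 0 ≤ s)
    (hμ : μ ≤ 𝔼 ε : I → Bool, F (signVec ε)) :
    Pr {ε : I → Bool | F (signVec ε) < μ - s} ≤ Real.exp (-(s ^ 2 / (8 * σ ^ 2))) := by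
  set l := s / (4 * σ ^ 2) with hl
  have hl0 : 0 ≤ l := by positivity
  have h1 := expect_exp_neg_le F hσ hl0
  have h2 : Pr {ε : I → Bool | F (signVec ε) < μ - s} ≤
      𝔼 ε : I → Bool, Real.exp (l * (μ - s)) * Real.exp (-(l * F (signVec ε))) := by
    refine Pr_le_expect (fun _ => by positivity) fun ε hε => ?_
    rw [← Real.exp_add, Real.one_le_exp_iff]
    have : l * F (signVec ε) ≤ l * (μ - s) := mul_le_mul_of_nonneg_left (le_of_lt hε) hl0
    linarith
  rw [← mul_expect] at h2
  refine h2.trans ((mul_le_mul_of_nonneg_left h1 (Real.exp_pos _).le).trans ?_)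
  rw [← Real.exp_add, Real.exp_le_exp]
  have h3 := mul_le_mul_of_nonneg_left hμ hl0
  have h4 : - (l * s) + 2 * l ^ 2 * σ ^ 2 = -(s ^ 2 / (8 * σ ^ 2)) := by
    rw [hl]; field_simp; ring
  linarith

theorem expect_signVec_mul (i j : I) :
    𝔼 ε : I → Bool, signVec ε i * signVec ε j = if i = j then 1 else 0 := by
  split_ifs with h
  · subst h
    rw [expect_congr rfl (g := fun _ => (1 : ℝ)) fun ε _ => by
      simp only [signVec]; split_ifs <;> norm_num]
    exact Fintype.expect_const 1
  · have hinv : Function.Involutive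
        fun ε : I → Bool => Function.update ε i (!(ε i)) := by
      intro ε; ext k; by_cases hk : k = i
      · subst hk; simp
      · simp [hk]
    have h1 : 𝔼 ε : I → Bool, signVec ε i * signVec ε j =
        𝔼 ε : I → Bool, -(signVec ε i * signVec ε j) := by
      refine Fintype.expect_equiv hinv.toPerm _ _ fun ε => ?_
      have hj : j ≠ i := fun h' => h h'.symm
      simp only [signVec, Function.Involutive.coe_toPerm, Function.update_self,
        Function.update_of_ne hj]
      cases ε i <;> cases ε j <;> norm_num
    rw [expect_neg_distrib] at h1
    linarith

/-- Rademacher sums are orthogonal in mean square. -/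
theorem expect_norm_sq_sum {E : Type*} [NormedAddCommGroup E] [InnerProductSpace ℝ E]
    (x : I → E) :
    𝔼 ε : I → Bool, ‖∑ i, signVec ε i • x i‖ ^ 2 = ∑ i, ‖x i‖ ^ 2 := by
  have h : ∀ ε : I → Bool, ‖∑ i, signVec ε i • x i‖ ^ 2 =
      ∑ i, ∑ j, (signVec ε i * signVec ε j) * inner ℝ (x i) (x j) := by
    intro ε
    rw [← real_inner_self_eq_norm_sq, sum_inner]
    refine sum_congr rfl fun i _ => ?_
    rw [inner_sum]
    refine sum_congr rfl fun j _ => ?_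
    rw [real_inner_smul_left, real_inner_smul_right]; ring
  simp only [h, expect_sum_comm, ← expect_mul, expect_signVec_mul]
  simp

theorem seminorm_le_sqrt_expect_sq (t : I → ℝ) :
    F t ≤ √(𝔼 ε : I → Bool, F (signVec ε) ^ 2) * √(∑ i, t i ^ 2) := by
  have rep : ∀ i, 𝔼 ε : I → Bool, (∑ j, signVec ε j * t j) * signVec ε i = t i := by
    intro i
    have h : ∀ ε : I → Bool, (∑ j, signVec ε j * t j) * signVec ε i =
        ∑ j, (signVec ε j * signVec ε i) * t j := fun ε => by
      rw [sum_mul]; exact sum_congr rfl fun j _ => by ring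
    simp only [h, expect_sum_comm, ← expect_mul, expect_signVec_mul]
    simp
  have hvec : (Fintype.card (I → Bool) : ℝ) • t =
      ∑ ε : I → Bool, (∑ j, signVec ε j * t j) • signVec ε := by
    ext i
    rw [Finset.sum_apply, Pi.smul_apply, ← rep i, smul_eq_mul, Fintype.card_mul_expect]
    rfl
  have hF : F t ≤ 𝔼 ε : I → Bool, |∑ j, signVec ε j * t j| * F (signVec ε) := by
    rw [Fintype.expect_eq_sum_div_card, le_div_iff₀ (by positivity), mul_comm]
    calc (Fintype.card (I → Bool) : ℝ) * F t = F ((Fintype.card (I → Bool) : ℝ) • t) := by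
          rw [map_smul_eq_mul, Real.norm_of_nonneg (by positivity)]
      _ ≤ ∑ ε : I → Bool, F ((∑ j, signVec ε j * t j) • signVec ε) := by
          rw [hvec]; exact Finset.le_sum_of_subadditive F (map_zero F).le (map_add_le_add F) _ _
      _ = _ := sum_congr rfl fun ε _ => by rw [map_smul_eq_mul, Real.norm_eq_abs]
  have hcs := expect_mul_sq_le_sq_mul_sq univ
    (fun ε : I → Bool => |∑ j, signVec ε j * t j|) (fun ε => F (signVec ε))
  have h2 : 𝔼 ε : I → Bool, |∑ j, signVec ε j * t j| ^ 2 = ∑ j, t j ^ 2 := by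
    simpa using expect_norm_sq_sum t
  rw [h2] at hcs
  rw [← Real.sqrt_mul (expect_nonneg fun _ _ => sq_nonneg _), mul_comm]
  exact hF.trans (Real.le_sqrt_of_sq_le hcs)

/-- Kahane's inequality, with the optimal order of growth in `q`. -/
theorem expect_rpow_le {q h : ℝ} (hq : 1 ≤ q) (h0 : 0 ≤ h)
    (hh : 𝔼 ε : I → Bool, F (signVec ε) ^ 2 ≤ h ^ 2) :
    𝔼 ε : I → Bool, F (signVec ε) ^ q ≤ (Real.exp 3 * √q * h) ^ q := by
  have hq0 : 0 < q := by linarith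
  have key : ∀ h : ℝ, 0 < h → 𝔼 ε : I → Bool, F (signVec ε) ^ 2 ≤ h ^ 2 →
      𝔼 ε : I → Bool, F (signVec ε) ^ q ≤ (Real.exp 3 * √q * h) ^ q := by
    intro h h0 hh
    have hσ : ∀ t, F t ≤ h * √(∑ i, t i ^ 2) := fun t =>
      (seminorm_le_sqrt_expect_sq F t).trans
        (mul_le_mul_of_nonneg_right (Real.sqrt_le_iff.2 ⟨h0.le, hh⟩) (Real.sqrt_nonneg _))
    have hμ : 𝔼 ε : I → Bool, F (signVec ε) ≤ h := by
      have hcs := expect_mul_sq_le_sq_mul_sq univ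
        (fun ε : I → Bool => F (signVec ε)) (fun ε => (1 : ℝ))
      simp only [mul_one, one_pow, Fintype.expect_const] at hcs
      exact abs_le_of_sq_le_sq' (hcs.trans hh) h0.le |>.2
    have hs : √q ^ 2 = q := Real.sq_sqrt hq0.le
    have hs0 : 0 < √q := Real.sqrt_pos.2 hq0
    have hs1 : √q ≤ q := by nlinarith [Real.one_le_sqrt.2 hq]
    have pt : ∀ x : ℝ, 0 ≤ x → x ^ q ≤ (√q * h) ^ q * Real.exp (√q / h * x) := by
      intro x hx
      have h1 : x / (√q * h) ≤ Real.exp (x / (√q * h)) := by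
        have := Real.add_one_le_exp (x / (√q * h)); linarith
      have h2 := Real.rpow_le_rpow (by positivity) h1 hq0.le
      rw [Real.div_rpow hx (by positivity), div_le_iff₀ (by positivity), ← Real.exp_mul,
        mul_comm] at h2
      have h3 : √q / h * x = x / (√q * h) * q := by
        field_simp
        rw [hs, mul_comm]
      rw [h3]
      exact h2
    calc 𝔼 ε : I → Bool, F (signVec ε) ^ q
        ≤ 𝔼 ε : I → Bool, (√q * h) ^ q * Real.exp (√q / h * F (signVec ε)) :=
          expect_le_expect fun ε _ => pt _ (apply_nonneg F _)
      _ ≤ (√q * h) ^ q * Real.exp (3 * q) := by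
          rw [← mul_expect]
          gcongr
          refine (expect_exp_le F hσ (l := √q / h) (by positivity)).trans (Real.exp_le_exp.2 ?_)
          have e1 : 2 * (√q / h) ^ 2 * h ^ 2 = 2 * q := by
            rw [div_pow, hs]; field_simp
          have e2 : √q / h * (𝔼 ε : I → Bool, F (signVec ε)) ≤ √q := by
            calc _ ≤ √q / h * h := by gcongr
              _ = √q := by field_simp
          linarith
      _ = _ := by
          rw [Real.exp_mul, mul_comm, ← Real.mul_rpow (by positivity) (by positivity), ← mul_assoc]
  rcases h0.eq_or_lt with rfl | h0
  · have hz : ∀ ε : I → Bool, F (signVec ε) = 0 := by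
      have h1 : 𝔼 ε : I → Bool, F (signVec ε) ^ 2 = 0 :=
        le_antisymm (by simpa using hh) (expect_nonneg fun _ _ => sq_nonneg _)
      rw [expect_eq_zero_iff_of_nonneg (fun _ _ => sq_nonneg _)] at h1
      intro ε
      simpa using h1 ε (mem_univ _)
    simp [hz, Real.zero_rpow hq0.ne']
  · exact key h h0 hh

theorem rpow_expect_le {Ω : Type*} [Fintype Ω] [Nonempty Ω] {q : ℝ} (hq : 1 ≤ q)
    {g : Ω → ℝ} (hg : ∀ ω, 0 ≤ g ω) : (𝔼 ω, g ω) ^ q ≤ 𝔼 ω, g ω ^ q := by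
  have hc := Real.rpow_arith_mean_le_arith_mean_rpow univ
    (fun _ : Ω => (Fintype.card Ω : ℝ)⁻¹) g (fun _ _ => by positivity) (by simp)
    (fun ω _ => hg ω) hq
  rw [← mul_sum, ← mul_sum] at hc
  rwa [Fintype.expect_eq_sum_div_card, Fintype.expect_eq_sum_div_card, div_eq_inv_mul,
    div_eq_inv_mul]

theorem expect_le_of_expect_rpow_le {Ω : Type*} [Fintype Ω] [Nonempty Ω] {q D : ℝ} (hq : 1 ≤ q)
    {g : Ω → ℝ} (hg : ∀ ω, 0 ≤ g ω) (hD : 0 ≤ D) (h : 𝔼 ω, g ω ^ q ≤ D ^ q) : 𝔼 ω, g ω ≤ D :=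
  (Real.rpow_le_rpow_iff (expect_nonneg fun ω _ => hg ω) hD (by linarith)).1
    ((rpow_expect_le hq hg).trans h)

end Concentration

section Nets

variable {E : Type*} [NormedAddCommGroup E] [NormedSpace ℝ E] [FiniteDimensional ℝ E]

theorem exists_half_net :
    ∃ N : Finset E, #N ≤ 5 ^ Module.finrank ℝ E ∧ (∀ c ∈ N, ‖c‖ ≤ 1) ∧
      ∀ x : E, ‖x‖ ≤ 1 → ∃ c ∈ N, ‖x - c‖ ≤ 1 / 2 := by
  classical
  let A : Set ℕ := {j | ∃ s : Finset E, #s = j ∧ (∀ c ∈ s, ‖c‖ ≤ 2) ∧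
    ∀ c ∈ s, ∀ d ∈ s, c ≠ d → 1 ≤ ‖c - d‖}
  have hne : A.Nonempty := ⟨0, ∅, by simp⟩
  have hbd : BddAbove A := by
    refine ⟨5 ^ Module.finrank ℝ E, ?_⟩
    rintro j ⟨s, rfl, h1, h2⟩
    exact Besicovitch.card_le_of_separated s h1 h2
  obtain ⟨s, hs, h1, h2⟩ := Nat.sSup_mem hne hbd
  have h3 : ∀ x : E, ‖x‖ ≤ 2 → ∃ c ∈ s, ‖x - c‖ ≤ 1 := by
    intro x hx
    by_contra! hc
    have hxs : x ∉ s := fun h => by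
      have := hc x h; simp at this; linarith
    have hmem : #s + 1 ∈ A := by
      refine ⟨insert x s, card_insert_of_notMem hxs, ?_, ?_⟩
      · intro c h
        rcases mem_insert.1 h with rfl | h
        exacts [hx, h1 c h]
      · intro c h d h' hcd
        rcases mem_insert.1 h with hx' | hm <;> rcases mem_insert.1 h' with hy' | hm'
        · exact absurd (hx'.trans hy'.symm) hcd
        · rw [hx']; exact (hc d hm').le
        · rw [hy', norm_sub_rev]; exact (hc c hm).le
        · exact h2 c hm d hm' hcd
    have := le_csSup hbd hmem
    omega
  refine ⟨s.image fun c => (1 / 2 : ℝ) • c,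
    card_image_le.trans (Besicovitch.card_le_of_separated s h1 h2), ?_, ?_⟩
  · intro c hc
    obtain ⟨d, hd, rfl⟩ := mem_image.1 hc
    rw [norm_smul]; norm_num
    linarith [h1 d hd]
  · intro x hx
    obtain ⟨c, hc, hxc⟩ := h3 ((2 : ℝ) • x) (by rw [norm_smul]; norm_num; linarith)
    refine ⟨_, mem_image_of_mem _ hc, ?_⟩
    have : x - (1 / 2 : ℝ) • c = (1 / 2 : ℝ) • ((2 : ℝ) • x - c) := by
      rw [smul_sub, smul_smul]; norm_num
    rw [this, norm_smul]; norm_num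
    linarith

theorem exists_dyadic_net (r : ℕ) :
    ∃ N : Finset E, #N ≤ 5 ^ (r * Module.finrank ℝ E) ∧
      (∀ c ∈ N, ‖c‖ ≤ 2 - 2 * (1 / 2) ^ r) ∧
      ∀ x : E, ‖x‖ ≤ 1 → ∃ c ∈ N, ‖x - c‖ ≤ (1 / 2 : ℝ) ^ r := by
  classical
  induction r with
  | zero => exact ⟨{0}, by simp, by simp, fun x hx => ⟨0, by simp, by simpa using hx⟩⟩
  | succ r ih =>
    obtain ⟨N, hN, hN2, hN3⟩ := ih
    obtain ⟨H, hH, hH2, hH3⟩ := exists_half_net (E := E)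
    refine ⟨(N ×ˢ H).image fun p => p.1 + (1 / 2 : ℝ) ^ r • p.2, ?_, ?_, ?_⟩
    · refine card_image_le.trans ?_
      rw [card_product, add_mul, pow_add, one_mul]
      exact Nat.mul_le_mul hN hH
    · intro c hc
      obtain ⟨⟨a, b⟩, hab, rfl⟩ := mem_image.1 hc
      obtain ⟨ha, hb⟩ := mem_product.1 hab
      have h1 := hN2 _ ha
      have h2 := hH2 _ hb
      have h3 : ‖(1 / 2 : ℝ) ^ r • b‖ ≤ (1 / 2) ^ r := by
        rw [norm_smul, Real.norm_of_nonneg (by positivity)]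
        exact mul_le_of_le_one_right (by positivity) h2
      refine (norm_add_le _ _).trans ?_
      rw [pow_succ]
      simp only at h1
      linarith
    · intro x hx
      obtain ⟨a, ha, hxa⟩ := hN3 x hx
      obtain ⟨b, hb, hxb⟩ := hH3 ((2 : ℝ) ^ r • (x - a)) (by
        rw [norm_smul, Real.norm_of_nonneg (by positivity)]
        calc _ ≤ (2 : ℝ) ^ r * (1 / 2) ^ r := by gcongr
          _ = 1 := by rw [← mul_pow]; norm_num)
      refine ⟨_, mem_image_of_mem _ (mk_mem_product ha hb), ?_⟩
      have h1 : x - (a + (1 / 2 : ℝ) ^ r • b) =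
          (1 / 2 : ℝ) ^ r • ((2 : ℝ) ^ r • (x - a) - b) := by
        rw [smul_sub, smul_smul, ← mul_pow]; norm_num; abel
      rw [h1, norm_smul, Real.norm_of_nonneg (by positivity), pow_succ]
      gcongr

theorem seminorm_exists_bound (p : Seminorm ℝ E) : ∃ C, 0 < C ∧ ∀ x, p x ≤ C * ‖x‖ := by
  refine Seminorm.bound_of_continuous_normedSpace p ?_
  exact continuousOn_univ.1 (p.convexOn.continuousOn isOpen_univ)

/-- A seminorm is controlled by its values on a net of the unit ball. -/
theorem seminorm_le_of_net (p : Seminorm ℝ E) {N : Finset E}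
    (hN : ∀ x : E, ‖x‖ ≤ 1 → ∃ c ∈ N, ‖x - c‖ ≤ 1 / 2) {D : ℝ} (hD : ∀ c ∈ N, p c ≤ D) (u : E) :
    p u ≤ 2 * D * ‖u‖ := by
  obtain ⟨C, hC0, hC⟩ := seminorm_exists_bound p
  have step : ∀ r : ℕ, ∀ x : E, ‖x‖ ≤ 1 → p x ≤ 2 * D + C * (1 / 2) ^ r := by
    have hD0 : 0 ≤ D := by
      obtain ⟨c, hc, -⟩ := hN 0 (by simp)
      exact (apply_nonneg p c).trans (hD c hc)
    intro r
    induction r with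
    | zero =>
      intro x hx
      have := hC x
      have := mul_le_of_le_one_right hC0.le hx
      simp; linarith
    | succ r ih =>
      intro x hx
      obtain ⟨c, hc, hxc⟩ := hN x hx
      have h1 := ih ((2 : ℝ) • (x - c)) (by rw [norm_smul]; norm_num; linarith)
      rw [map_smul_eq_mul] at h1
      have h2 := map_add_le_add p c (x - c)
      rw [add_sub_cancel] at h2
      have h3 := hD c hc
      rw [pow_succ]
      norm_num at h1 ⊢
      linarith
  have lim : ∀ x : E, ‖x‖ ≤ 1 → p x ≤ 2 * D := by
    intro x hx
    have ht : Filter.Tendsto (fun r : ℕ => 2 * D + C * (1 / 2 : ℝ) ^ r) Filter.atTop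
        (nhds (2 * D + C * 0)) :=
      ((tendsto_pow_atTop_nhds_zero_of_lt_one (by norm_num) (by norm_num)).const_mul C).const_add _
    rw [mul_zero, add_zero] at ht
    exact ge_of_tendsto' ht fun r => step r x hx
  rcases eq_or_ne u 0 with rfl | hu
  · simp
  · have hu' : 0 < ‖u‖ := norm_pos_iff.2 hu
    have h1 := lim (‖u‖⁻¹ • u) (by rw [norm_smul]; simp [hu])
    rw [map_smul_eq_mul, norm_inv, norm_norm, inv_mul_le_iff₀ hu'] at h1
    linarith

end Nets

section Lq

variable {ι E : Type*} [AddCommGroup E] [Module ℝ E]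

/-- The `ℓ_q`-sum of a family of seminorms. -/
noncomputable def lqSeminorm {q : ℝ} (hq : 1 ≤ q) (s : Finset ι) (p : ι → Seminorm ℝ E) :
    Seminorm ℝ E :=
  Seminorm.of (fun x => (∑ i ∈ s, p i x ^ q) ^ (1 / q))
    (fun x y => by
      refine le_trans ?_ (Real.Lp_add_le_of_nonneg s hq
        (fun i _ => apply_nonneg (p i) x) fun i _ => apply_nonneg (p i) y)
      gcongr with i _
      exact map_add_le_add _ _ _)
    (fun a x => by
      have h : ∀ i, p i (a • x) ^ q = ‖a‖ ^ q * p i x ^ q := fun i => by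
        rw [map_smul_eq_mul, Real.mul_rpow (norm_nonneg _) (apply_nonneg _ _)]
      simp only [h]
      rw [← mul_sum, Real.mul_rpow (by positivity)
        (sum_nonneg fun i _ => Real.rpow_nonneg (apply_nonneg _ _) _), ← Real.rpow_mul
        (norm_nonneg _), mul_one_div_cancel (by linarith), Real.rpow_one])

variable {q : ℝ} (hq : 1 ≤ q) (s : Finset ι) (p : ι → Seminorm ℝ E)

theorem lqSeminorm_rpow (x : E) : lqSeminorm hq s p x ^ q = ∑ i ∈ s, p i x ^ q := by
  change ((∑ i ∈ s, p i x ^ q) ^ (1 / q)) ^ q = _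
  rw [← Real.rpow_mul (sum_nonneg fun i _ => Real.rpow_nonneg (apply_nonneg _ _) _),
    one_div_mul_cancel (by linarith), Real.rpow_one]

theorem lqSeminorm_le {x : E} {D : ℝ} (hD : 0 ≤ D) (h : ∑ i ∈ s, p i x ^ q ≤ D ^ q) :
    lqSeminorm hq s p x ≤ D := by
  rw [← lqSeminorm_rpow hq s p x] at h
  exact (Real.rpow_le_rpow_iff (apply_nonneg _ _) hD (by linarith)).1 h

theorem sum_rpow_le_sqrt_rpow {q : ℝ} (hq : 2 ≤ q) (s : Finset ι) {a : ι → ℝ}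
    (ha : ∀ i ∈ s, 0 ≤ a i) : ∑ i ∈ s, a i ^ q ≤ √(∑ i ∈ s, a i ^ 2) ^ q := by
  set S := √(∑ i ∈ s, a i ^ 2) with hS
  have hS2 : S ^ 2 = ∑ i ∈ s, a i ^ 2 := Real.sq_sqrt (sum_nonneg fun _ _ => sq_nonneg _)
  have hS0 : 0 ≤ S := Real.sqrt_nonneg _
  have split : ∀ x : ℝ, 0 ≤ x → x ^ q = x ^ 2 * x ^ (q - 2) := fun x hx => by
    rw [← Real.rpow_natCast, ← Real.rpow_add_of_nonneg hx (by norm_num) (by linarith)]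
    norm_num
  rw [split S hS0, hS2, sum_mul]
  refine sum_le_sum fun i hi => ?_
  rw [split _ (ha i hi)]
  have : a i ≤ S := Real.le_sqrt_of_sq_le
    (single_le_sum (f := fun i => a i ^ 2) (fun _ _ => sq_nonneg _) hi)
  have := ha i hi
  gcongr

theorem lqSeminorm_le_sqrt (hq2 : 2 ≤ q) (x : E) :
    lqSeminorm hq s p x ≤ √(∑ i ∈ s, p i x ^ 2) :=
  lqSeminorm_le hq s p (Real.sqrt_nonneg _)
    (sum_rpow_le_sqrt_rpow hq2 s fun i _ => apply_nonneg (p i) x)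

theorem le_lqSeminorm {i : ι} (hi : i ∈ s) (x : E) : p i x ≤ lqSeminorm hq s p x := by
  refine (Real.rpow_le_rpow_iff (apply_nonneg _ _) (apply_nonneg _ _)
    (by linarith : (0 : ℝ) < q)).1 ?_
  rw [lqSeminorm_rpow]
  exact single_le_sum (f := fun i => p i x ^ q)
    (fun i _ => Real.rpow_nonneg (apply_nonneg (p i) x) _) hi

end Lq

section John

theorem exists_one_lt_pow_mul {k : ℕ} {s : ℝ} (hk : 1 ≤ k) (hs : k < s) :
    ∃ t : ℝ, 0 < t ∧ t < 1 ∧ 1 < (1 - t) ^ (k - 1) * (1 - t + t * s) := by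
  have hk' : (1 : ℝ) ≤ k := by exact_mod_cast hk
  obtain ⟨t, ht0, ht⟩ := exists_between
    (show (0 : ℝ) < min 1 ((s - k) / ((k - 1) * (s - 1) + 1)) from
      lt_min one_pos (div_pos (by linarith) (by nlinarith)))
  refine ⟨t, ht0, ht.trans_le (min_le_left _ _), ?_⟩
  have ht1 : t < 1 := ht.trans_le (min_le_left _ _)
  have ht2 := ht.trans_le (min_le_right _ _)
  rw [lt_div_iff₀ (by nlinarith)] at ht2
  have hb := one_add_mul_le_pow (show (-2 : ℝ) ≤ -t by linarith) (k - 1)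
  rw [Nat.cast_sub hk, ← sub_eq_add_neg] at hb
  push_cast at hb
  have h1 : 0 < 1 - t + t * s := by nlinarith
  have h2 := mul_le_mul_of_nonneg_right hb h1.le
  nlinarith

variable {V : Type*} [NormedAddCommGroup V] [NormedSpace ℝ V]
variable {E : Type*} [NormedAddCommGroup E] [InnerProductSpace ℝ E]

theorem norm_sq_add_inner_smul {e : E} (he : ‖e‖ = 1) (c : ℝ) (y : E) :
    ‖y + (c * inner ℝ e y) • e‖ ^ 2 = ‖y‖ ^ 2 + ((1 + c) ^ 2 - 1) * (inner ℝ e y) ^ 2 := by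
  rw [norm_add_sq_real, real_inner_smul_right, norm_smul, he, real_inner_comm, Real.norm_eq_abs,
    mul_one, sq_abs]
  ring

/-- John's theorem: some ellipsoid approximates the unit ball up to the square root of the
dimension. -/
theorem exists_john [FiniteDimensional ℝ V] [FiniteDimensional ℝ E]
    (hd : Module.finrank ℝ E = Module.finrank ℝ V)
    (hpos : 0 < Module.finrank ℝ V) :
    ∃ T : E ≃ₗ[ℝ] V, ∀ x, ‖x‖ ≤ √(Module.finrank ℝ V) * ‖T x‖ ∧ ‖T x‖ ≤ ‖x‖ := by
  set k := Module.finrank ℝ V with hk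
  let e₀ : E ≃L[ℝ] V := ContinuousLinearEquiv.ofFinrankEq hd
  let f : (V →L[ℝ] E) → ℝ := fun M => |(M.comp (e₀ : E →L[ℝ] V)).det|
  have hf : Continuous f := by
    refine continuous_abs.comp (ContinuousLinearMap.continuous_det.comp ?_)
    fun_prop
  have : ProperSpace (V →L[ℝ] E) := FiniteDimensional.proper_real _
  obtain ⟨M, hMK, hM⟩ := (isCompact_closedBall (0 : V →L[ℝ] E) 1).exists_isMaxOn
    ⟨0, by simp⟩ hf.continuousOn
  have hM1 : ∀ x, ‖M x‖ ≤ ‖x‖ := fun x => by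
    have := M.le_of_opNorm_le (by simpa using hMK) x
    simpa using this
  have hdet : 0 < f M := by
    set c := ‖(e₀.symm : V →L[ℝ] E)‖ + 1
    have hc : 0 < c := by positivity
    have h1 : c⁻¹ • (e₀.symm : V →L[ℝ] E) ∈ Metric.closedBall (0 : V →L[ℝ] E) 1 := by
      rw [mem_closedBall_zero_iff, norm_smul, norm_inv, Real.norm_of_nonneg hc.le,
        inv_mul_le_iff₀ hc]
      simp [c]
    refine lt_of_lt_of_le ?_ (hM h1)
    have h2 : (c⁻¹ • (e₀.symm : V →L[ℝ] E)).comp (e₀ : E →L[ℝ] V) =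
        c⁻¹ • ContinuousLinearMap.id ℝ E := by ext x; simp
    change 0 < |((c⁻¹ • (e₀.symm : V →L[ℝ] E)).comp (e₀ : E →L[ℝ] V)).det|
    rw [h2]
    change 0 < |LinearMap.det (c⁻¹ • (LinearMap.id : E →ₗ[ℝ] E))|
    rw [LinearMap.det_smul, LinearMap.det_id]
    positivity
  have hunit : (M.comp (e₀ : E →L[ℝ] V)).det ≠ 0 := abs_pos.1 hdet
  have hinj : Function.Injective M := by
    have h1 : Function.Injective ((M.comp (e₀ : E →L[ℝ] V) : E →L[ℝ] E) : E →ₗ[ℝ] E) :=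
      (LinearMap.equivOfDetNeZero _ hunit).injective
    intro x y hxy
    have h2 : e₀.symm x = e₀.symm y := h1 (by simpa using hxy)
    exact e₀.symm.injective h2
  let Me : V ≃ₗ[ℝ] E := LinearEquiv.ofInjectiveOfFinrankEq (M : V →ₗ[ℝ] E) hinj hd.symm
  have hMe : ∀ x, Me x = M x := fun x => rfl
  have hk0 : (0 : ℝ) < √k := Real.sqrt_pos.2 (by exact_mod_cast hpos)
  have key : ∀ x, ‖x‖ ≤ √k * ‖M x‖ := by
    by_contra! hx
    obtain ⟨x₀, hx₀⟩ := hx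
    obtain ⟨g, hg1, hg⟩ := exists_dual_vector'' ℝ x₀
    let w : E := (InnerProductSpace.toDual ℝ E).symm
      (LinearMap.toContinuousLinearMap ((g : V →ₗ[ℝ] ℝ) ∘ₗ (Me.symm : E →ₗ[ℝ] V)))
    have hw : ∀ x, inner ℝ w (M x) = g x := fun x => by
      rw [InnerProductSpace.toDual_symm_apply, ← hMe]
      simp
    have hgx : ∀ x, |g x| ≤ ‖x‖ := fun x => by
      simpa using g.le_of_opNorm_le hg1 x
    have hwk : √k < ‖w‖ := by
      have h1 := real_inner_le_norm w (M x₀)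
      rw [hw, hg] at h1
      exact lt_of_mul_lt_mul_right (hx₀.trans_le h1) (norm_nonneg _)
    have hw0 : 0 < ‖w‖ := hk0.trans hwk
    have hs : (k : ℝ) < ‖w‖ ^ 2 := by
      rw [← Real.sq_sqrt (Nat.cast_nonneg k)]
      gcongr
    obtain ⟨t, ht0, ht1, ht⟩ := exists_one_lt_pow_mul hpos hs
    set a := √(1 - t) with ha
    set d := √(1 - t + t * ‖w‖ ^ 2) with hdd
    have ha2 : a ^ 2 = 1 - t := Real.sq_sqrt (by linarith)
    have hd2 : d ^ 2 = 1 - t + t * ‖w‖ ^ 2 := Real.sq_sqrt (by nlinarith)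
    have ha0 : 0 < a := Real.sqrt_pos.2 (by linarith)
    set e : E := ‖w‖⁻¹ • w with he
    have he1 : ‖e‖ = 1 := by rw [he, norm_smul]; simp [hw0.ne']
    have hev : ∀ x, inner ℝ e (M x) = ‖w‖⁻¹ * g x := fun x => by
      rw [he, real_inner_smul_left, hw]
    let φ : Module.Dual ℝ E := (d / a - 1) • (innerSL ℝ e : E →ₗ[ℝ] ℝ)
    let D : E →ₗ[ℝ] E := a • LinearMap.transvection φ e
    have hDv : ∀ y, D y = a • (y + ((d / a - 1) * inner ℝ e y) • e) := fun y => rfl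
    have hDn : ∀ x, ‖D (M x)‖ ≤ ‖x‖ := by
      intro x
      refine abs_le_of_sq_le_sq' ?_ (norm_nonneg _) |>.2
      rw [hDv, norm_smul, mul_pow, norm_sq_add_inner_smul he1, hev, Real.norm_of_nonneg ha0.le]
      have h1 : a ^ 2 * (‖M x‖ ^ 2 + ((1 + (d / a - 1)) ^ 2 - 1) * (‖w‖⁻¹ * g x) ^ 2) =
          a ^ 2 * ‖M x‖ ^ 2 + (d ^ 2 - a ^ 2) * (‖w‖⁻¹ * g x) ^ 2 := by
        field_simp
        ring
      have h2 : (d ^ 2 - a ^ 2) * (‖w‖⁻¹ * g x) ^ 2 = t * g x ^ 2 := by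
        rw [hd2, ha2]; field_simp; ring
      rw [h1, h2, ha2]
      have h3 : ‖M x‖ ^ 2 ≤ ‖x‖ ^ 2 := by gcongr; exact hM1 x
      have h4 : g x ^ 2 ≤ ‖x‖ ^ 2 := by rw [← sq_abs]; gcongr; exact hgx x
      nlinarith
    have hmem : (LinearMap.toContinuousLinearMap D).comp M ∈
        Metric.closedBall (0 : V →L[ℝ] E) 1 := by
      rw [mem_closedBall_zero_iff]
      exact ContinuousLinearMap.opNorm_le_bound _ zero_le_one fun x => by simpa using hDn x
    have hle : f ((LinearMap.toContinuousLinearMap D).comp M) ≤ f M := hM hmem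
    have hmul : f ((LinearMap.toContinuousLinearMap D).comp M) = |LinearMap.det D| * f M := by
      simp only [f, ContinuousLinearMap.det]
      rw [← abs_mul, ← LinearMap.det_comp]
      rfl
    rw [hmul] at hle
    have hD1 : |LinearMap.det D| ≤ 1 := by
      by_contra! h
      nlinarith
    have hdetD : LinearMap.det D = a ^ (k - 1) * d := by
      simp only [D]
      rw [LinearMap.det_smul, LinearMap.transvection.det, hd]
      have : φ e = d / a - 1 := by simp [φ, he1]
      rw [this]
      obtain ⟨j, hj⟩ : ∃ j, k = j + 1 := ⟨k - 1, by omega⟩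
      rw [hj, pow_succ, Nat.add_sub_cancel]
      field_simp
      ring
    have h5 : (LinearMap.det D) ^ 2 ≤ 1 := by rw [← sq_abs]; exact pow_le_one₀ (abs_nonneg _) hD1
    rw [hdetD, mul_pow, ← pow_mul, mul_comm (k - 1), pow_mul, ha2, hd2] at h5
    linarith
  refine ⟨(LinearEquiv.smulOfNeZero ℝ E (√k)⁻¹ (inv_ne_zero hk0.ne')).trans Me.symm, fun y => ?_⟩
  obtain ⟨x, rfl⟩ := Me.surjective y
  have h1 : ((LinearEquiv.smulOfNeZero ℝ E (√k)⁻¹ (inv_ne_zero hk0.ne')).trans Me.symm) (Me x) =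
      (√k)⁻¹ • x := by
    simp [LinearEquiv.trans_apply]
  rw [h1, norm_smul, norm_inv, Real.norm_of_nonneg hk0.le, hMe]
  constructor
  · rw [mul_inv_cancel_left₀ hk0.ne']; exact hM1 x
  · rw [inv_mul_le_iff₀ hk0]; exact key x

end John

section Cotype

variable {X : Type*} [NormedAddCommGroup X] [NormedSpace ℝ X]

theorem radAvg_eq_expect {M : ℕ} (x : Fin M → X) :
    radAvg x = 𝔼 ε : Fin M → Bool, ‖∑ i, signVec ε i • x i‖ ^ 2 := by
  rw [Fintype.expect_eq_sum_div_card, radAvg, div_eq_inv_mul]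
  simp [signVec]

theorem exists_cotype_bound [FiniteDimensional ℝ X] {q : ℝ} (hq : 2 ≤ q) :
    ∃ C : ℝ, 0 ≤ C ∧ ∀ (M : ℕ) (x : Fin M → X),
      (∑ i, ‖x i‖ ^ q) ^ (1 / q) ≤ C * √(radAvg x) := by
  let e : EuclideanSpace ℝ (Fin (Module.finrank ℝ X)) ≃L[ℝ] X :=
    ContinuousLinearEquiv.ofFinrankEq (by simp)
  set A := ‖(e : EuclideanSpace ℝ (Fin (Module.finrank ℝ X)) →L[ℝ] X)‖
  set B := ‖(e.symm : X →L[ℝ] EuclideanSpace ℝ (Fin (Module.finrank ℝ X)))‖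
  refine ⟨A * B, by positivity, fun M x => ?_⟩
  have hA : ∀ v, ‖v‖ ≤ A * ‖e.symm v‖ := fun v => by
    simpa using (e : EuclideanSpace ℝ (Fin (Module.finrank ℝ X)) →L[ℝ] X).le_opNorm (e.symm v)
  have hB : ∀ v, ‖e.symm v‖ ≤ B * ‖v‖ := fun v =>
    (e.symm : X →L[ℝ] EuclideanSpace ℝ (Fin (Module.finrank ℝ X))).le_opNorm v
  have h1 : (∑ i, ‖x i‖ ^ q) ^ (1 / q) ≤ √(∑ i, ‖x i‖ ^ 2) := by
    rw [one_div, Real.rpow_inv_le_iff_of_pos (by positivity) (Real.sqrt_nonneg _) (by linarith)]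
    exact sum_rpow_le_sqrt_rpow hq univ fun i _ => norm_nonneg _
  refine h1.trans (Real.sqrt_le_iff.2 ⟨by positivity, ?_⟩)
  have h0 : 0 ≤ radAvg x := by
    rw [radAvg_eq_expect]; exact expect_nonneg fun _ _ => sq_nonneg _
  rw [mul_pow, Real.sq_sqrt h0, radAvg_eq_expect]
  calc ∑ i, ‖x i‖ ^ 2 ≤ ∑ i, A ^ 2 * ‖e.symm (x i)‖ ^ 2 := by
        gcongr with i _
        rw [← mul_pow]
        gcongr
        exact hA _
    _ = A ^ 2 * 𝔼 ε : Fin M → Bool, ‖∑ i, signVec ε i • e.symm (x i)‖ ^ 2 := by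
        rw [expect_norm_sq_sum, mul_sum]
    _ ≤ A ^ 2 * 𝔼 ε : Fin M → Bool, B ^ 2 * ‖∑ i, signVec ε i • x i‖ ^ 2 := by
        gcongr with ε _
        rw [← mul_pow]
        gcongr
        have := hB (∑ i, signVec ε i • x i)
        rwa [map_sum, sum_congr rfl fun i _ => map_smul _ _ _] at this
    _ = _ := by rw [← mul_expect]; ring

theorem cotype_ineq_of_cotypeConst_le [FiniteDimensional ℝ X] {q Γ : ℝ} (hq : 2 ≤ q) (hΓ : 0 < Γ)
    (h : cotypeConst q X ≤ Γ) {M : ℕ} (x : Fin M → X) :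
    (∑ i, ‖x i‖ ^ q) ^ (1 / q) ≤ 2 * Γ * √(radAvg x) := by
  obtain ⟨C₀, hC₀⟩ := exists_cotype_bound (X := X) hq
  obtain ⟨C, hC, hlt⟩ := exists_lt_of_csInf_lt ⟨C₀, hC₀⟩
    (show cotypeConst q X < 2 * Γ by linarith)
  exact (hC.2 M x).trans (by gcongr)

theorem cotypeConst_le {q C : ℝ} (hC : 0 ≤ C)
    (h : ∀ (M : ℕ) (x : Fin M → X), (∑ i, ‖x i‖ ^ q) ^ (1 / q) ≤ C * √(radAvg x)) :
    cotypeConst q X ≤ C :=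
  csInf_le ⟨0, fun _ h => h.1⟩ ⟨hC, h⟩

/-- A subspace of an `ℓ_q`-sum of copies of `V` inherits the cotype `q` of `V`. -/
theorem cotypeConst_le_of_lq_sum {V ι : Type*} [NormedAddCommGroup V] [NormedSpace ℝ V]
    [Fintype ι] {q C : ℝ} (hq : 2 ≤ q) (hC : 0 ≤ C)
    (hV : ∀ (M : ℕ) (x : Fin M → V), (∑ i, ‖x i‖ ^ q) ^ (1 / q) ≤ C * √(radAvg x))
    (L : ι → X →ₗ[ℝ] V) (hL : ∀ y, ‖y‖ ^ q = ∑ i, ‖L i y‖ ^ q) :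
    cotypeConst q X ≤ C * (Real.exp 3 * √q) := by
  have hq0 : 0 < q := by linarith
  refine cotypeConst_le (by positivity) fun M x => ?_
  have hr0 : 0 ≤ radAvg x := by
    rw [radAvg_eq_expect]; exact expect_nonneg fun _ _ => sq_nonneg _
  let F : Seminorm ℝ (Fin M → ℝ) := (normSeminorm ℝ X).comp (Fintype.linearCombination ℝ x)
  have hF : ∀ t, F t = ‖∑ i, t i • x i‖ := fun t => by
    simp [F, Fintype.linearCombination_apply]
  have hK : 𝔼 ε : Fin M → Bool, F (signVec ε) ^ q ≤ (Real.exp 3 * √q * √(radAvg x)) ^ q := by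
    refine expect_rpow_le F (by linarith) (Real.sqrt_nonneg _) ?_
    rw [Real.sq_sqrt hr0, radAvg_eq_expect]
    simp only [hF, le_refl]
  have hrow : ∀ i, ∑ a, ‖L i (x a)‖ ^ q ≤
      C ^ q * 𝔼 ε : Fin M → Bool, ‖L i (∑ a, signVec ε a • x a)‖ ^ q := by
    intro i
    have h1 := hV M fun a => L i (x a)
    rw [one_div, Real.rpow_inv_le_iff_of_pos (by positivity) (by positivity) hq0,
      Real.mul_rpow hC (Real.sqrt_nonneg _)] at h1
    refine h1.trans ?_
    gcongr
    rw [radAvg_eq_expect, Real.sqrt_eq_rpow, ← Real.rpow_mul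
      (expect_nonneg fun _ _ => sq_nonneg _), one_div_mul_eq_div]
    refine (rpow_expect_le (by linarith) fun _ => sq_nonneg _).trans (le_of_eq ?_)
    refine expect_congr rfl fun ε _ => ?_
    rw [← Real.rpow_natCast, ← Real.rpow_mul (norm_nonneg _), map_sum,
      sum_congr rfl fun a _ => map_smul (L i) (signVec ε a) (x a)]
    congr 1
    push_cast
    ring
  rw [one_div, Real.rpow_inv_le_iff_of_pos (by positivity) (by positivity) hq0]
  calc ∑ a, ‖x a‖ ^ q = ∑ i, ∑ a, ‖L i (x a)‖ ^ q := by
        rw [sum_comm]; exact sum_congr rfl fun a _ => hL _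
    _ ≤ ∑ i, C ^ q * 𝔼 ε : Fin M → Bool, ‖L i (∑ a, signVec ε a • x a)‖ ^ q :=
        sum_le_sum fun i _ => hrow i
    _ = C ^ q * 𝔼 ε : Fin M → Bool, F (signVec ε) ^ q := by
        rw [← mul_sum, ← expect_sum_comm]
        congr 1
        exact expect_congr rfl fun ε _ => by rw [hF, hL]
    _ ≤ C ^ q * (Real.exp 3 * √q * √(radAvg x)) ^ q := by gcongr
    _ = _ := by rw [← Real.mul_rpow hC (by positivity)]; congr 1; ring

end Cotype

section Reduction

/-- A dominant coordinate of an `ℓ_q`-sum yields a well complemented copy of `V`. -/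
theorem exists_complemented_copy {Y V E ι : Type*} [NormedAddCommGroup Y] [NormedSpace ℝ Y]
    [NormedAddCommGroup V] [NormedSpace ℝ V] [FiniteDimensional ℝ V]
    [AddCommGroup E] [Module ℝ E] [FiniteDimensional ℝ E]
    [Fintype ι] [DecidableEq ι] {q : ℝ} (hq : 0 < q)
    (L : ι → Y →ₗ[ℝ] V) (hL : ∀ y, ‖y‖ ^ q = ∑ i, ‖L i y‖ ^ q)
    (H : Submodule ℝ Y) (S : E →ₗ[ℝ] Y) (hS : ∀ u, S u ∈ H) (j : ι)
    (hd : Module.finrank ℝ E = Module.finrank ℝ V)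
    (hinj : ∀ u, L j (S u) = 0 → u = 0)
    (hj : ∀ u, ∑ i ∈ univ.erase j, ‖L i (S u)‖ ^ q ≤ ‖L j (S u)‖ ^ q) :
    ∃ E' : Submodule ℝ H, ComplementedIn ((2 : ℝ) ^ (1 / q)) E' ∧
      IsomorphicTo ((2 : ℝ) ^ (1 / q)) V E' := by
  let B : E ≃ₗ[ℝ] V := LinearEquiv.ofInjectiveOfFinrankEq (L j ∘ₗ S)
    ((injective_iff_map_eq_zero _).2 hinj) hd
  let T : V →ₗ[ℝ] H := (S ∘ₗ (B.symm : V →ₗ[ℝ] E)).codRestrict H fun v => hS _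
  have hT : ∀ v, (T v : Y) = S (B.symm v) := fun v => rfl
  have hLT : ∀ v, L j (T v : Y) = v := fun v => B.apply_symm_apply v
  have hle : ∀ y, ‖L j y‖ ≤ ‖y‖ := fun y => by
    refine (Real.rpow_le_rpow_iff (norm_nonneg _) (norm_nonneg _) hq).1 ?_
    rw [hL y]
    exact single_le_sum (f := fun i => ‖L i y‖ ^ q) (fun i _ => by positivity) (mem_univ j)
  have hTn : ∀ v, ‖(T v : Y)‖ ≤ 2 ^ (1 / q) * ‖v‖ := fun v => by
    refine (Real.rpow_le_rpow_iff (norm_nonneg _) (by positivity) hq).1 ?_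
    rw [hL, Real.mul_rpow (by positivity) (norm_nonneg _), ← Real.rpow_mul (by norm_num),
      one_div_mul_cancel hq.ne', Real.rpow_one, ← add_sum_erase _ _ (mem_univ j)]
    have h1 := hj (B.symm v)
    rw [← hT, hLT] at h1
    rw [hLT]
    linarith
  have hTinj : Function.Injective T := fun v w h => by
    rw [← hLT v, ← hLT w, h]
  refine ⟨LinearMap.range T, ⟨T ∘ₗ L j ∘ₗ H.subtype, ?_, ?_, ?_⟩,
    LinearEquiv.ofInjective T hTinj, 1, one_pos, fun v => ?_⟩
  · ext y
    simp [hLT]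
  · refine le_antisymm (LinearMap.range_comp_le_range _ _) ?_
    rintro _ ⟨v, rfl⟩
    exact ⟨T v, by simp [hLT]⟩
  · intro y
    refine (hTn _).trans ?_
    gcongr
    exact hle _
  · rw [one_mul]
    refine ⟨?_, hTn v⟩
    have := hle (T v : Y)
    rwa [hLT] at this

theorem exists_lq_space {W V ι : Type} [AddCommGroup W] [Module ℝ W]
    [NormedAddCommGroup V] [NormedSpace ℝ V] [Fintype ι] {q : ℝ} (hq : 1 ≤ q)
    (L : ι → W →ₗ[ℝ] V) (hL : ∀ w, (∀ i, L i w = 0) → w = 0) :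
    ∃ (Y : Type) (_ : NormedAddCommGroup Y) (_ : NormedSpace ℝ Y) (Φ : W ≃ₗ[ℝ] Y),
      ∀ w, ‖Φ w‖ ^ q = ∑ i, ‖L i w‖ ^ q := by
  have hq0 : 0 < q := by linarith
  have htr : (ENNReal.ofReal q).toReal = q := ENNReal.toReal_ofReal hq0.le
  have : Fact (1 ≤ ENNReal.ofReal q) := ⟨by
    rw [← ENNReal.ofReal_one]; exact ENNReal.ofReal_le_ofReal hq⟩
  let Ψ : W →ₗ[ℝ] PiLp (ENNReal.ofReal q) fun _ : ι => V :=
    (WithLp.linearEquiv (ENNReal.ofReal q) ℝ (ι → V)).symm.toLinearMap ∘ₗ LinearMap.pi L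
  have hΨ : ∀ w i, Ψ w i = L i w := fun w i => rfl
  have hinj : Function.Injective Ψ := (injective_iff_map_eq_zero _).2 fun w hw =>
    hL w fun i => by rw [← hΨ, hw]; rfl
  refine ⟨LinearMap.range Ψ, inferInstance, inferInstance, LinearEquiv.ofInjective Ψ hinj,
    fun w => ?_⟩
  change ‖Ψ w‖ ^ q = _
  rw [PiLp.norm_eq_sum (by rw [htr]; exact hq0), htr, ← Real.rpow_mul (by positivity),
    one_div_mul_cancel hq0.ne', Real.rpow_one]
  rfl

/-- The Euclidean form of the embedding property: a family of maps into a `k`-dimensional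
Euclidean space such that every `m`-dimensional subspace sees one of them dominating. -/
def HasDominant (q : ℝ) (n m k : ℕ) : Prop :=
  ∃ (N : ℕ) (G : Fin N → EuclideanSpace ℝ (Fin n) →ₗ[ℝ] EuclideanSpace ℝ (Fin k)) (ρ : ℝ), 0 < ρ ∧
    ∀ b : Fin m → EuclideanSpace ℝ (Fin n), Orthonormal ℝ b →
      ∃ (j : Fin N) (S : EuclideanSpace ℝ (Fin k) →ₗ[ℝ] EuclideanSpace ℝ (Fin n)), ∀ u,
        S u ∈ Submodule.span ℝ (Set.range b) ∧ ρ * √k * ‖u‖ ≤ ‖G j (S u)‖ ∧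
        ∑ i ∈ univ.erase j, ‖G i (S u)‖ ^ q ≤ (ρ / 2 * ‖u‖) ^ q ∧ ‖S u‖ ≤ n * ‖u‖

theorem exists_space_of_hasDominant {q : ℝ} (hq : 2 < q) {n m₀ k : ℕ} (hk : 0 < k) (hn : 0 < n)
    (hG : HasDominant q n m₀ k) {V : Type} [NormedAddCommGroup V] [NormedSpace ℝ V]
    [FiniteDimensional ℝ V] (hV : Module.finrank ℝ V = k) {C : ℝ} (hC : 0 ≤ C)
    (hVC : ∀ (M : ℕ) (x : Fin M → V), (∑ i, ‖x i‖ ^ q) ^ (1 / q) ≤ C * √(radAvg x)) :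
    ∃ (Y : Type) (_ : NormedAddCommGroup Y) (_ : NormedSpace ℝ Y),
      Module.finrank ℝ Y = n ∧ cotypeConst q Y ≤ C * (Real.exp 3 * √q) ∧
      ∀ m : ℕ, m₀ ≤ m → m ≤ n →
      ∀ Ysub : Submodule ℝ Y, Module.finrank ℝ Ysub = m →
      ∃ E : Submodule ℝ Ysub,
        ComplementedIn ((2 : ℝ) ^ (1 / q)) E ∧ IsomorphicTo ((2 : ℝ) ^ (1 / q)) V E := by
  classical
  obtain ⟨N, G, ρ, hρ, hb⟩ := hG
  have hq0 : 0 < q := by linarith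
  have hn0 : (0 : ℝ) < n := by exact_mod_cast hn
  have hn1 : (1 : ℝ) ≤ n := by exact_mod_cast hn
  have hk0 : (0 : ℝ) < √k := Real.sqrt_pos.2 (by exact_mod_cast hk)
  obtain ⟨T, hT⟩ := exists_john (V := V) (E := EuclideanSpace ℝ (Fin k)) (by simp [hV])
    (by omega)
  rw [hV] at hT
  have : Nontrivial V := Module.finrank_pos_iff.1 (by omega : 0 < Module.finrank ℝ V)
  obtain ⟨v₀, hv₀⟩ := exists_norm_eq V (zero_le_one (α := ℝ))
  set η : ℝ := ρ / (2 * (n * n)) with hη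
  have hη0 : 0 < η := by positivity
  let L : Fin N ⊕ Fin n → EuclideanSpace ℝ (Fin n) →ₗ[ℝ] V := Sum.elim
    (fun i => (T : EuclideanSpace ℝ (Fin k) →ₗ[ℝ] V) ∘ₗ G i)
    (fun t => (EuclideanSpace.projₗ (𝕜 := ℝ) t).smulRight (η • v₀))
  have hLl : ∀ i w, L (Sum.inl i) w = T (G i w) := fun i w => rfl
  have hLr : ∀ t w, L (Sum.inr t) w = w t • (η • v₀) := fun t w => rfl
  have hLrn : ∀ t w, ‖L (Sum.inr t) w‖ = |w t| * η := fun t w => by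
    rw [hLr, norm_smul, norm_smul, hv₀, mul_one, Real.norm_eq_abs, Real.norm_of_nonneg hη0.le]
  obtain ⟨Y, i1, i2, Φ, hΦ⟩ := exists_lq_space (by linarith : 1 ≤ q) L (fun w hw => by
    ext t
    have h1 := hLrn t w
    rw [hw, norm_zero] at h1
    have h2 : |w t| = 0 := by
      rcases mul_eq_zero.1 h1.symm with h | h
      exacts [h, absurd h hη0.ne']
    simpa using h2)
  have hY : ∀ y, ‖y‖ ^ q = ∑ i, ‖(L i ∘ₗ (Φ.symm : Y →ₗ[ℝ] EuclideanSpace ℝ (Fin n))) y‖ ^ q :=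
    fun y => by simpa using hΦ (Φ.symm y)
  refine ⟨Y, i1, i2, by rw [← Φ.finrank_eq]; simp, cotypeConst_le_of_lq_sum hq.le hC hVC _ hY, ?_⟩
  intro m hm₀ hmn H hH
  let H' : Submodule ℝ (EuclideanSpace ℝ (Fin n)) := H.comap (Φ : _ →ₗ[ℝ] Y)
  have hH' : Module.finrank ℝ H' = m := by
    rw [← hH]
    exact (Φ.ofSubmodule' H).finrank_eq
  let bs := stdOrthonormalBasis ℝ H'
  let b : Fin m₀ → EuclideanSpace ℝ (Fin n) := fun a => bs (Fin.castLE (by omega) a)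
  have hbo : Orthonormal ℝ b := by
    have h1 := bs.orthonormal.comp (Fin.castLE (by omega : m₀ ≤ Module.finrank ℝ H'))
      (Fin.castLE_injective _)
    exact h1.comp_linearIsometry H'.subtypeₗᵢ
  have hspan : Submodule.span ℝ (Set.range b) ≤ H' := by
    rw [Submodule.span_le]
    rintro _ ⟨a, rfl⟩
    exact (bs _).2
  obtain ⟨j, S, hS⟩ := hb b hbo
  have hlow : ∀ u, ρ * ‖u‖ ≤ ‖T (G j (S u))‖ := fun u => by
    have h1 := (hT (G j (S u))).1
    have h2 := (hS u).2.1
    have h3 : √k * (ρ * ‖u‖) ≤ √k * ‖T (G j (S u))‖ := by linarith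
    exact le_of_mul_le_mul_left h3 hk0
  refine exists_complemented_copy hq0 _ hY H (Φ.toLinearMap ∘ₗ S) (fun u => hspan (hS u).1)
    (Sum.inl j) (by simp [hV]) (fun u hu => ?_) fun u => ?_
  · have h1 : T (G j (S u)) = 0 := by simpa [hLl] using hu
    have h2 := hlow u
    rw [h1, norm_zero] at h2
    have h3 : ‖u‖ ≤ 0 := by nlinarith [norm_nonneg u]
    exact norm_le_zero_iff.1 h3
  · have hsimp : ∀ i, (L i ∘ₗ (Φ.symm : Y →ₗ[ℝ] EuclideanSpace ℝ (Fin n)))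
        ((Φ.toLinearMap ∘ₗ S) u) = L i (S u) := fun i => by simp
    simp only [hsimp]
    have hsplit : ∑ i ∈ univ.erase (Sum.inl j : Fin N ⊕ Fin n), ‖L i (S u)‖ ^ q =
        ∑ i ∈ univ.erase j, ‖T (G i (S u))‖ ^ q + ∑ t, ‖L (Sum.inr t) (S u)‖ ^ q := by
      have h1 := add_sum_erase univ (fun i => ‖L i (S u)‖ ^ q)
        (mem_univ (Sum.inl j : Fin N ⊕ Fin n))
      have h2 := add_sum_erase univ (fun i => ‖T (G i (S u))‖ ^ q) (mem_univ j)
      rw [Fintype.sum_sum_type] at h1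
      simp only [hLl] at h1 h2 ⊢
      linarith
    have hA : ∑ i ∈ univ.erase j, ‖T (G i (S u))‖ ^ q ≤ (ρ / 2 * ‖u‖) ^ q := by
      refine le_trans (sum_le_sum fun i _ => ?_) (hS u).2.2.1
      gcongr
      exact (hT _).2
    have hB : ∑ t, ‖L (Sum.inr t) (S u)‖ ^ q ≤ (ρ / 2 * ‖u‖) ^ q := by
      have hpt : ∀ t, ‖L (Sum.inr t) (S u)‖ ≤ (n : ℝ)⁻¹ * (ρ / 2 * ‖u‖) := fun t => by
        rw [hLrn]
        have h1 : |S u t| ≤ n * ‖u‖ := (PiLp.norm_apply_le (S u) t).trans (hS u).2.2.2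
        calc |S u t| * η ≤ n * ‖u‖ * η := by gcongr
          _ = _ := by rw [hη]; field_simp
      calc ∑ t, ‖L (Sum.inr t) (S u)‖ ^ q ≤ ∑ t : Fin n, ((n : ℝ)⁻¹ * (ρ / 2 * ‖u‖)) ^ q := by
            gcongr with t _
            exact hpt t
        _ = (n * (n : ℝ)⁻¹ ^ q) * (ρ / 2 * ‖u‖) ^ q := by
            rw [sum_const, card_univ, Fintype.card_fin, nsmul_eq_mul,
              Real.mul_rpow (by positivity) (by positivity), mul_assoc]
        _ ≤ 1 * (ρ / 2 * ‖u‖) ^ q := by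
            gcongr
            calc (n : ℝ) * (n : ℝ)⁻¹ ^ q ≤ n * (n : ℝ)⁻¹ ^ (1 : ℝ) := by
                  gcongr n * ?_
                  exact Real.rpow_le_rpow_of_exponent_ge (by positivity)
                    (inv_le_one_of_one_le₀ hn1) (by linarith)
              _ = 1 := by rw [Real.rpow_one]; field_simp
        _ = _ := one_mul _
    rw [hsplit]
    calc _ ≤ (ρ / 2 * ‖u‖) ^ q + (ρ / 2 * ‖u‖) ^ q := add_le_add hA hB
      _ = 2 * (1 / 2) ^ q * (ρ * ‖u‖) ^ q := by
          rw [show ρ / 2 * ‖u‖ = 1 / 2 * (ρ * ‖u‖) by ring,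
            Real.mul_rpow (by norm_num) (by positivity)]
          ring
      _ ≤ 1 * (ρ * ‖u‖) ^ q := by
          gcongr
          calc 2 * (1 / 2 : ℝ) ^ q ≤ 2 * (1 / 2 : ℝ) ^ (1 : ℝ) := by
                gcongr 2 * ?_
                exact Real.rpow_le_rpow_of_exponent_ge (by norm_num) (by norm_num) (by linarith)
            _ = 1 := by norm_num
      _ ≤ ‖T (G j (S u))‖ ^ q := by
          rw [one_mul]
          gcongr
          exact hlow u
      _ = _ := rfl

end Reduction

section Matrices

/-- The `n`-dimensional Euclidean space. -/
abbrev Euc (n : ℕ) := EuclideanSpace ℝ (Fin n)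

variable {n m k : ℕ}

/-- The operator given by a `k × n` matrix. -/
noncomputable def act : (Fin k × Fin n → ℝ) →ₗ[ℝ] Euc n →ₗ[ℝ] Euc k :=
  Fintype.linearCombination ℝ fun p =>
    (EuclideanSpace.projₗ (𝕜 := ℝ) p.2).smulRight (EuclideanSpace.single p.1 (1 : ℝ))

/-- The operator given by the transpose of a `k × n` matrix. -/
noncomputable def coact : (Fin k × Fin n → ℝ) →ₗ[ℝ] Euc k →ₗ[ℝ] Euc n :=
  Fintype.linearCombination ℝ fun p =>
    (EuclideanSpace.projₗ (𝕜 := ℝ) p.1).smulRight (EuclideanSpace.single p.2 (1 : ℝ))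

theorem act_eq_sum (t : Fin k × Fin n → ℝ) (x : Euc n) :
    act t x = ∑ p, t p • (x p.2 • EuclideanSpace.single p.1 (1 : ℝ)) := by
  simp [act, Fintype.linearCombination_apply, LinearMap.sum_apply]

theorem coact_eq_sum (t : Fin k × Fin n → ℝ) (u : Euc k) :
    coact t u = ∑ p, t p • (u p.1 • EuclideanSpace.single p.2 (1 : ℝ)) := by
  simp [coact, Fintype.linearCombination_apply, LinearMap.sum_apply]

theorem act_apply (t : Fin k × Fin n → ℝ) (x : Euc n) (a : Fin k) :
    act t x a = ∑ c, t (a, c) * x c := by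
  rw [act_eq_sum, Fintype.sum_prod_type, WithLp.ofLp_sum, Finset.sum_apply,
    Finset.sum_eq_single a]
  · simp [WithLp.ofLp_sum, Finset.sum_apply]
  · intro b _ hb
    simp [WithLp.ofLp_sum, Finset.sum_apply, hb.symm]
  · simp

theorem coact_apply (t : Fin k × Fin n → ℝ) (u : Euc k) (c : Fin n) :
    coact t u c = ∑ a, t (a, c) * u a := by
  rw [coact_eq_sum, Fintype.sum_prod_type, WithLp.ofLp_sum, Finset.sum_apply]
  refine sum_congr rfl fun a _ => ?_
  rw [WithLp.ofLp_sum, Finset.sum_apply, Finset.sum_eq_single c]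
  · simp
  · intro b _ hb
    simp [hb.symm]
  · simp

theorem inner_act (t : Fin k × Fin n → ℝ) (x : Euc n) (u : Euc k) :
    inner ℝ (act t x) u = inner ℝ x (coact t u) := by
  simp only [PiLp.inner_apply, act_apply, coact_apply, RCLike.inner_apply, conj_trivial, mul_sum,
    sum_mul]
  rw [sum_comm]
  exact sum_congr rfl fun c _ => sum_congr rfl fun a _ => by ring

theorem norm_act_le (t : Fin k × Fin n → ℝ) (x : Euc n) :
    ‖act t x‖ ≤ √(∑ p, t p ^ 2) * ‖x‖ := by
  rw [EuclideanSpace.norm_eq, EuclideanSpace.norm_eq, ← Real.sqrt_mul (by positivity)]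
  refine Real.sqrt_le_sqrt ?_
  rw [Fintype.sum_prod_type, sum_mul]
  refine sum_le_sum fun a _ => ?_
  simp only [Real.norm_eq_abs, sq_abs]
  rw [act_apply]
  exact sum_mul_sq_le_sq_mul_sq _ _ _

theorem norm_coact_le (t : Fin k × Fin n → ℝ) (u : Euc k) :
    ‖coact t u‖ ≤ √(∑ p, t p ^ 2) * ‖u‖ := by
  rw [EuclideanSpace.norm_eq, EuclideanSpace.norm_eq, ← Real.sqrt_mul (by positivity)]
  refine Real.sqrt_le_sqrt ?_
  rw [Fintype.sum_prod_type_right, sum_mul]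
  refine sum_le_sum fun a _ => ?_
  simp only [Real.norm_eq_abs, sq_abs]
  rw [coact_apply]
  exact sum_mul_sq_le_sq_mul_sq _ _ _

theorem sum_signVec_sq {I : Type*} [Fintype I] (ε : I → Bool) :
    ∑ i, signVec ε i ^ 2 = Fintype.card I := by
  rw [sum_congr rfl (g := fun _ => (1 : ℝ)) fun i _ => by
    simp only [signVec]; split_ifs <;> norm_num]
  simp

theorem norm_coact_signVec_le (ε : Fin k × Fin n → Bool) (u : Euc k) :
    ‖coact (signVec ε) u‖ ≤ √(k * n) * ‖u‖ := by
  have h := norm_coact_le (signVec ε) u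
  rw [sum_signVec_sq] at h
  simpa using h

theorem norm_coact_signVec_single_sq (ε : Fin k × Fin n → Bool) (a : Fin k) :
    ‖coact (signVec ε) (EuclideanSpace.single a 1)‖ ^ 2 = n := by
  rw [EuclideanSpace.norm_sq_eq]
  have h : ∀ c, ‖coact (signVec ε) (EuclideanSpace.single a (1 : ℝ)) c‖ ^ 2 = 1 := fun c => by
    rw [coact_apply, Finset.sum_eq_single a]
    · simp only [signVec, PiLp.single_apply]
      split_ifs <;> norm_num
    · intro b _ hb
      simp [hb]
    · simp
  rw [sum_congr rfl fun c _ => h c]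
  simp

theorem expect_norm_act_sq (x : Euc n) :
    𝔼 ε : Fin k × Fin n → Bool, ‖act (signVec ε) x‖ ^ 2 = k * ‖x‖ ^ 2 := by
  simp only [act_eq_sum]
  rw [expect_norm_sq_sum, Fintype.sum_prod_type]
  simp [norm_smul, EuclideanSpace.norm_sq_eq]

theorem expect_norm_map_coact_sq {W : Type*} [NormedAddCommGroup W] [InnerProductSpace ℝ W]
    (A : Euc n →ₗ[ℝ] W) (u : Euc k) :
    𝔼 ε : Fin k × Fin n → Bool, ‖A (coact (signVec ε) u)‖ ^ 2 =
      ‖u‖ ^ 2 * ∑ c, ‖A (EuclideanSpace.single c 1)‖ ^ 2 := by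
  simp only [coact_eq_sum, map_sum, map_smul]
  rw [expect_norm_sq_sum, Fintype.sum_prod_type, EuclideanSpace.norm_sq_eq, sum_mul]
  refine sum_congr rfl fun a _ => ?_
  simp [norm_smul, mul_sum, mul_pow]

/-- A linear map and its adjoint have the same Hilbert–Schmidt norm. -/
theorem sum_norm_sq_single_eq (A : Euc n →ₗ[ℝ] Euc k) (B : Euc k →ₗ[ℝ] Euc n)
    (h : ∀ x u, inner ℝ (A x) u = inner ℝ x (B u)) :
    ∑ c, ‖A (EuclideanSpace.single c 1)‖ ^ 2 = ∑ a, ‖B (EuclideanSpace.single a 1)‖ ^ 2 := by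
  simp only [EuclideanSpace.norm_sq_eq]
  rw [sum_comm]
  refine sum_congr rfl fun a _ => sum_congr rfl fun c _ => ?_
  have h1 := h (EuclideanSpace.single c 1) (EuclideanSpace.single a 1)
  simp only [EuclideanSpace.inner_single_left, EuclideanSpace.inner_single_right] at h1
  simp only [conj_trivial, one_mul] at h1
  rw [h1]

end Matrices

section Projection

variable {n m k : ℕ}

/-- The orthogonal projection onto the span of an orthonormal family. -/
noncomputable def proj (b : Fin m → Euc n) : Euc n →ₗ[ℝ] Euc n :=
  ∑ a, (innerSL ℝ (b a) : Euc n →ₗ[ℝ] ℝ).smulRight (b a)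

theorem proj_apply (b : Fin m → Euc n) (x : Euc n) :
    proj b x = ∑ a, inner ℝ (b a) x • b a := by
  simp [proj, LinearMap.sum_apply]

theorem proj_mem_span (b : Fin m → Euc n) (x : Euc n) :
    proj b x ∈ Submodule.span ℝ (Set.range b) := by
  rw [proj_apply]
  exact Submodule.sum_mem _ fun a _ => Submodule.smul_mem _ _ (Submodule.subset_span ⟨a, rfl⟩)

theorem inner_proj_comm (b : Fin m → Euc n) (x y : Euc n) :
    inner ℝ (proj b x) y = inner ℝ x (proj b y) := by
  simp only [proj_apply, sum_inner, inner_sum, real_inner_smul_left, real_inner_smul_right]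
  exact sum_congr rfl fun a _ => by rw [real_inner_comm (b a) x]; ring

theorem norm_proj_sq {b : Fin m → Euc n} (hb : Orthonormal ℝ b) (x : Euc n) :
    ‖proj b x‖ ^ 2 = ∑ a, inner ℝ (b a) x ^ 2 := by
  rw [← real_inner_self_eq_norm_sq, proj_apply, hb.inner_sum]
  simp [sq]

theorem inner_proj_self {b : Fin m → Euc n} (hb : Orthonormal ℝ b) (x : Euc n) :
    inner ℝ (proj b x) x = ‖proj b x‖ ^ 2 := by
  rw [norm_proj_sq hb, proj_apply, sum_inner]
  exact sum_congr rfl fun a _ => by rw [real_inner_smul_left, sq]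

theorem norm_proj_le {b : Fin m → Euc n} (hb : Orthonormal ℝ b) (x : Euc n) :
    ‖proj b x‖ ≤ ‖x‖ := by
  have h1 := real_inner_le_norm (proj b x) x
  rw [inner_proj_self hb, sq] at h1
  by_contra! h
  nlinarith [norm_nonneg x]

theorem sum_norm_proj_single_sq {b : Fin m → Euc n} (hb : Orthonormal ℝ b) :
    ∑ c, ‖proj b (EuclideanSpace.single c 1)‖ ^ 2 = m := by
  simp only [norm_proj_sq hb]
  rw [sum_comm]
  have h : ∀ a, ∑ c, inner ℝ (b a) (EuclideanSpace.single c (1 : ℝ)) ^ 2 = 1 := fun a => by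
    have h1 := EuclideanSpace.norm_sq_eq (b a)
    rw [hb.norm_eq_one] at h1
    simp only [EuclideanSpace.inner_single_right, one_mul]
    simpa using h1.symm
  simp [h]

theorem norm_proj_sub_le {b b' : Fin m → Euc n} (hb : Orthonormal ℝ b) (hb' : Orthonormal ℝ b')
    {δ : ℝ} (hδ : ∀ a, ‖b a - b' a‖ ≤ δ) (x : Euc n) :
    ‖proj b x - proj b' x‖ ≤ 2 * m * δ * ‖x‖ := by
  rw [proj_apply, proj_apply, ← sum_sub_distrib]
  refine (norm_sum_le _ _).trans ?_
  have h : ∀ a, ‖inner ℝ (b a) x • b a - inner ℝ (b' a) x • b' a‖ ≤ 2 * δ * ‖x‖ := by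
    intro a
    have e : inner ℝ (b a) x • b a - inner ℝ (b' a) x • b' a =
        inner ℝ (b a) x • (b a - b' a) + inner ℝ (b a - b' a) x • b' a := by
      rw [inner_sub_left, smul_sub, sub_smul]; abel
    rw [e]
    refine (norm_add_le _ _).trans ?_
    rw [norm_smul, norm_smul, hb'.norm_eq_one, Real.norm_eq_abs, Real.norm_eq_abs]
    have h1 := abs_real_inner_le_norm (b a) x
    have h2 := abs_real_inner_le_norm (b a - b' a) x
    rw [hb.norm_eq_one, one_mul] at h1
    have h3 := hδ a
    have h4 : |inner ℝ (b a) x| * ‖b a - b' a‖ ≤ ‖x‖ * δ := by gcongr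
    have h5 : ‖b a - b' a‖ * ‖x‖ ≤ δ * ‖x‖ := by gcongr
    linarith
  calc _ ≤ ∑ a : Fin m, 2 * δ * ‖x‖ := sum_le_sum fun a _ => h a
    _ = _ := by simp; ring

theorem sum_norm_act_proj_single_sq_le {b : Fin m → Euc n} (hb : Orthonormal ℝ b)
    (ε : Fin k × Fin n → Bool) :
    ∑ c, ‖act (signVec ε) (proj b (EuclideanSpace.single c 1))‖ ^ 2 ≤ k * n := by
  have h := sum_norm_sq_single_eq (act (signVec ε) ∘ₗ proj b) (proj b ∘ₗ coact (signVec ε))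
    fun x u => by simp only [LinearMap.comp_apply]; rw [inner_act, inner_proj_comm]
  simp only [LinearMap.comp_apply] at h
  rw [h]
  calc _ ≤ ∑ a : Fin k, (n : ℝ) := by
        refine sum_le_sum fun a _ => ?_
        rw [← norm_coact_signVec_single_sq ε a]
        gcongr
        exact norm_proj_le hb _
    _ = _ := by simp

/-- Coercivity of `G P G^*` from below. -/
theorem le_norm_act_proj_coact {b : Fin m → Euc n} (hb : Orthonormal ℝ b)
    (t : Fin k × Fin n → ℝ) {s : ℝ} (hs : 0 ≤ s) {u : Euc k} (h : s * ‖u‖ ≤ ‖proj b (coact t u)‖) :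
    s ^ 2 * ‖u‖ ≤ ‖act t (proj b (coact t u))‖ := by
  rcases eq_or_ne u 0 with rfl | hu
  · simp
  have hu' : 0 < ‖u‖ := norm_pos_iff.2 hu
  have h1 := real_inner_le_norm (act t (proj b (coact t u))) u
  rw [inner_act, inner_proj_self hb] at h1
  have h2 : (s * ‖u‖) ^ 2 ≤ ‖proj b (coact t u)‖ ^ 2 := by gcongr
  refine le_of_mul_le_mul_right ?_ hu'
  linarith [mul_pow s ‖u‖ 2, sq ‖u‖]

/-- A finite net of orthonormal families. -/
theorem exists_orthonormal_net (n m r : ℕ) :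
    ∃ B : Finset (Fin m → Euc n), #B ≤ 5 ^ (r * n * m) ∧ (∀ b ∈ B, Orthonormal ℝ b) ∧
      ∀ b : Fin m → Euc n, Orthonormal ℝ b →
        ∃ b' ∈ B, ∀ a, ‖b a - b' a‖ ≤ 2 * (1 / 2) ^ r := by
  classical
  obtain ⟨N, hN, -, hN2⟩ := exists_dyadic_net (E := Euc n) r
  rw [finrank_euclideanSpace_fin] at hN
  let near : (Fin m → Euc n) → (Fin m → Euc n) → Prop := fun f b =>
    Orthonormal ℝ b ∧ ∀ a, ‖b a - f a‖ ≤ (1 / 2) ^ r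
  let rep : (Fin m → Euc n) → (Fin m → Euc n) := fun f =>
    if h : ∃ b, near f b then h.choose else 0
  have hrep : ∀ f, (∃ b, near f b) → near f (rep f) := fun f h => by
    simp only [rep, h, dite_true]
    exact h.choose_spec
  refine ⟨((Fintype.piFinset fun _ : Fin m => N).filter fun f => ∃ b, near f b).image rep,
    ?_, ?_, ?_⟩
  · refine card_image_le.trans ((card_filter_le _ _).trans ?_)
    rw [Fintype.card_piFinset, prod_const, card_univ, Fintype.card_fin, pow_mul]
    exact Nat.pow_le_pow_left hN m
  · intro b hb
    obtain ⟨f, hf, rfl⟩ := mem_image.1 hb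
    exact (hrep f (mem_filter.1 hf).2).1
  · intro b hb
    choose f hf hfb using fun a => hN2 (b a) (hb.norm_eq_one a).le
    have hex : ∃ b, near f b := ⟨b, hb, hfb⟩
    refine ⟨rep f, mem_image_of_mem _ (mem_filter.2 ⟨Fintype.mem_piFinset.2 hf, hex⟩), fun a => ?_⟩
    have h1 := (hrep f hex).2 a
    have h2 := hfb a
    have h3 := norm_sub_le_norm_sub_add_norm_sub (b a) (f a) (rep f a)
    rw [norm_sub_rev (f a)] at h3
    linarith

end Projection

section Independence

theorem Pr_equiv {Ω Ω' : Type*} [Fintype Ω] [Fintype Ω'] (e : Ω ≃ Ω') (s : Set Ω') :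
    Pr (e ⁻¹' s) = Pr s :=
  Fintype.expect_equiv e _ _ fun _ => rfl

theorem expect_update {ι X : Type*} [Fintype ι] [DecidableEq ι] [Fintype X] [Nonempty X]
    (f : (ι → X) → ℝ) (j : ι) :
    𝔼 ω, f ω = 𝔼 ω, 𝔼 x, f (Function.update ω j x) := by
  classical
  let φ : (ι → X) × X → (ι → X) × X := fun p => (Function.update p.1 j p.2, p.1 j)
  have hφ : Function.Involutive φ := fun p => by simp [φ]
  have h1 : 𝔼 ω, 𝔼 x, f (Function.update ω j x) = 𝔼 p : (ι → X) × X, f (φ p).1 := by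
    rw [← univ_product_univ, expect_product]
  have h2 : 𝔼 p : (ι → X) × X, f (φ p).1 = 𝔼 p : (ι → X) × X, f p.1 :=
    Fintype.expect_equiv hφ.toPerm _ _ fun _ => rfl
  rw [h1, h2, ← univ_product_univ, expect_product]
  exact expect_congr rfl fun ω _ => by simp

/-- Coordinates on which the event and the relation do not depend are independent. -/
theorem Pr_forall_mem_le {ι X : Type*} [Fintype ι] [DecidableEq ι] [Fintype X] [Nonempty X]
    {Q : (ι → X) → Prop} {R : (ι → X) → X → Prop} {δ : ℝ} (hδ : 0 ≤ δ)
    (hQR : ∀ ω, Q ω → Pr {x | R ω x} ≤ δ) (J : Finset ι)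
    (hQ : ∀ ω, ∀ j ∈ J, ∀ x, Q (Function.update ω j x) ↔ Q ω)
    (hR : ∀ ω, ∀ j ∈ J, ∀ x y, R (Function.update ω j x) y ↔ R ω y) :
    Pr {ω | Q ω ∧ ∀ i ∈ J, R ω (ω i)} ≤ δ ^ #J := by
  induction J using Finset.induction_on with
  | empty =>
    refine (Pr_le_expect (h := fun _ => 1) (by simp) (by simp)).trans ?_
    rw [Fintype.expect_const]
    simp
  | insert j J hj ih =>
    specialize ih (fun ω i hi => hQ ω i (mem_insert_of_mem hi))
      (fun ω i hi => hR ω i (mem_insert_of_mem hi))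
    have key : ∀ ω, 𝔼 x, ({ω | Q ω ∧ ∀ i ∈ insert j J, R ω (ω i)} : Set (ι → X)).indicator
        (1 : (ι → X) → ℝ) (Function.update ω j x) ≤
        δ * ({ω | Q ω ∧ ∀ i ∈ J, R ω (ω i)} : Set (ι → X)).indicator (1 : (ι → X) → ℝ) ω := by
      intro ω
      have hmem : ∀ x, Function.update ω j x ∈ {ω | Q ω ∧ ∀ i ∈ insert j J, R ω (ω i)} ↔
          ω ∈ {ω | Q ω ∧ ∀ i ∈ J, R ω (ω i)} ∧ x ∈ {x | R ω x} := by
        intro x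
        simp only [Set.mem_ofPred_eq, forall_mem_insert, hQ ω j (mem_insert_self j J) x,
          Function.update_self, hR ω j (mem_insert_self j J) x]
        have : (∀ i ∈ J, R ω (Function.update ω j x i)) ↔ ∀ i ∈ J, R ω (ω i) :=
          forall₂_congr fun i hi => by
            rw [Function.update_of_ne (ne_of_mem_of_not_mem hi hj)]
        rw [this]
        tauto
      by_cases hω : ω ∈ {ω | Q ω ∧ ∀ i ∈ J, R ω (ω i)}
      · rw [Set.indicator_of_mem hω]
        refine le_trans (le_of_eq ?_) ((hQR ω hω.1).trans (by simp))
        refine expect_congr rfl fun x _ => ?_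
        by_cases hx : x ∈ {x | R ω x}
        · rw [Set.indicator_of_mem hx, Set.indicator_of_mem ((hmem x).2 ⟨hω, hx⟩)]
          rfl
        · rw [Set.indicator_of_notMem hx, Set.indicator_of_notMem fun h => hx ((hmem x).1 h).2]
      · rw [Set.indicator_of_notMem hω, mul_zero]
        refine le_of_eq (expect_eq_zero fun x _ => ?_)
        exact Set.indicator_of_notMem (fun h => hω ((hmem x).1 h).1) _
    rw [card_insert_of_notMem hj, pow_succ']
    unfold Pr at ih ⊢
    rw [expect_update _ j]
    refine (expect_le_expect fun ω _ => key ω).trans ?_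
    rw [← mul_expect]
    exact mul_le_mul_of_nonneg_left ih hδ

/-- Decoupling by a random splitting of the index set. -/
theorem exists_splitting {ι : Type*} [Fintype ι] [DecidableEq ι] (W : ι → (ι → Bool) → Prop)
    (hW : ∀ j s, W j (Function.update s j true) ∨ W j (Function.update (fun i => !s i) j true)) :
    ∃ (s : ι → Bool) (J : Finset ι), (∀ j ∈ J, s j = true ∧ W j s) ∧ Fintype.card ι ≤ 4 * #J := by
  classical
  let f : ι → (ι → Bool) → ℝ := fun j s => if s j = true ∧ W j s then 1 else 0
  have hj : ∀ j, 1 / 4 ≤ 𝔼 s, f j s := by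
    intro j
    let g : (ι → Bool) → ℝ := fun s => if W j (Function.update s j true) then 1 else 0
    have h1 : 𝔼 s, f j s = 𝔼 s, 1 / 2 * g s := by
      rw [expect_update _ j]
      refine expect_congr rfl fun s _ => ?_
      rw [Fintype.expect_eq_sum_div_card]
      simp only [f, g, Fintype.sum_bool, Function.update_self, true_and, Fintype.card_bool]
      split_ifs <;> simp_all
    have h2 : 𝔼 s : ι → Bool, g (fun i => !s i) = 𝔼 s, g s := by
      have hinv : Function.Involutive fun (s : ι → Bool) i => !s i := fun s => by simp
      exact Fintype.expect_equiv hinv.toPerm _ _ fun _ => rfl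
    have h3 : 1 ≤ 𝔼 s, g s + 𝔼 s : ι → Bool, g (fun i => !s i) := by
      rw [← expect_add_distrib]
      calc (1 : ℝ) = 𝔼 s : ι → Bool, 1 := (Fintype.expect_const _).symm
        _ ≤ _ := expect_le_expect fun s _ => by
          rcases hW j s with h | h <;> simp only [g, h, if_true] <;> split_ifs <;> norm_num
    rw [h1, ← mul_expect]
    linarith
  have hsum : (Fintype.card ι : ℝ) / 4 ≤ 𝔼 s, ∑ j, f j s := by
    rw [expect_sum_comm]
    calc (Fintype.card ι : ℝ) / 4 = ∑ j : ι, (1 / 4 : ℝ) := by simp; ring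
      _ ≤ _ := sum_le_sum fun j _ => hj j
  obtain ⟨s, -, hs⟩ := exists_le_of_le_expect univ_nonempty hsum
  refine ⟨s, univ.filter fun j => s j = true ∧ W j s, by simp, ?_⟩
  simp only [f, sum_boole] at hs
  have : (Fintype.card ι : ℝ) ≤ 4 * #(univ.filter fun j => s j = true ∧ W j s) := by linarith
  exact_mod_cast this

end Independence

section Mean

theorem two_add_sq_le_exp_add_exp_neg (y : ℝ) : 2 + y ^ 2 ≤ Real.exp y + Real.exp (-y) := by
  have h1 : (y / 2) ^ 2 ≤ Real.sinh (y / 2) ^ 2 := by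
    rcases le_total 0 (y / 2) with h | h
    · have := Real.self_le_sinh_iff.2 h
      gcongr
    · have := Real.sinh_le_self_iff.2 h
      nlinarith
  have h2 := Real.cosh_two_mul (y / 2)
  rw [Real.cosh_sq, show 2 * (y / 2) = y by ring, Real.cosh_eq] at h2
  linarith

variable {I : Type*} [Fintype I] [DecidableEq I] (F : Seminorm ℝ (I → ℝ)) {σ : ℝ}

/-- The variance of a seminorm of a random sign vector is controlled by its Lipschitz constant. -/
theorem expect_sq_le (hσ : ∀ t, F t ≤ σ * √(∑ i, t i ^ 2)) (hσ0 : 0 < σ) :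
    𝔼 ε : I → Bool, F (signVec ε) ^ 2 ≤ (𝔼 ε : I → Bool, F (signVec ε)) ^ 2 + 4 * σ ^ 2 := by
  set l := 1 / (√2 * σ) with hl
  have hl0 : 0 ≤ l := by positivity
  have hl2 : l ^ 2 * σ ^ 2 = 1 / 2 := by
    rw [hl, div_pow, mul_pow, Real.sq_sqrt (by norm_num)]
    field_simp
  have h := expect_exp_mul_expect_exp_neg_le F hσ hl0
  rw [mul_assoc, hl2] at h
  have pt : ∀ a b : ℝ, 2 + l ^ 2 * (a ^ 2 + b ^ 2 - 2 * (a * b)) ≤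
      Real.exp (l * a) * Real.exp (-(l * b)) + Real.exp (l * b) * Real.exp (-(l * a)) := by
    intro a b
    rw [← Real.exp_add, ← Real.exp_add]
    have h1 := two_add_sq_le_exp_add_exp_neg (l * a - l * b)
    rw [← sub_eq_add_neg, show l * b + -(l * a) = -(l * a - l * b) by ring]
    nlinarith
  have h2 : 𝔼 ε : I → Bool, 𝔼 η : I → Bool, (2 + l ^ 2 * (F (signVec ε) ^ 2 + F (signVec η) ^ 2 -
      2 * (F (signVec ε) * F (signVec η)))) ≤
      𝔼 ε : I → Bool, 𝔼 η : I → Bool,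
        (Real.exp (l * F (signVec ε)) * Real.exp (-(l * F (signVec η))) +
          Real.exp (l * F (signVec η)) * Real.exp (-(l * F (signVec ε)))) :=
    expect_le_expect fun ε _ => expect_le_expect fun η _ => pt _ _
  simp only [expect_add_distrib, expect_sub_distrib, ← mul_expect, ← expect_mul,
    Fintype.expect_const] at h2
  have h3 := Real.exp_one_lt_d9
  rw [show 2 * (1 / 2 : ℝ) = 1 by norm_num] at h
  set v := 𝔼 ε : I → Bool, F (signVec ε) ^ 2
  set μ := 𝔼 ε : I → Bool, F (signVec ε)
  have h4 : l ^ 2 * (v - μ ^ 2) ≤ 2 := by nlinarith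
  have h5 : (l ^ 2 * (v - μ ^ 2)) * σ ^ 2 ≤ 2 * σ ^ 2 := by gcongr
  nlinarith

end Mean

section BadSigns

variable {n m k : ℕ}

/-- Matrices of signs for which the compression to the span of `b` is degenerate, or which are
not small for the seminorm `T`. -/
def badSigns (b : Fin m → Euc n) (T : Seminorm ℝ (Euc n)) (τ : ℝ) :
    Set (Fin k × Fin n → Bool) :=
  {ε | ¬ ((∀ u : Euc k, 1 / 4 * √m * ‖u‖ ≤ ‖proj b (coact (signVec ε) u)‖) ∧
    ∀ u : Euc k, T (proj b (coact (signVec ε) u)) ≤ 2 * τ * ‖u‖)}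

/-- The seminorm `t ↦ T (P t^* u)` on the space of matrices. -/
noncomputable def signSeminorm (b : Fin m → Euc n) (T : Seminorm ℝ (Euc n)) (u : Euc k) :
    Seminorm ℝ (Fin k × Fin n → ℝ) :=
  T.comp (proj b ∘ₗ (coact.flip u))

theorem signSeminorm_apply (b : Fin m → Euc n) (T : Seminorm ℝ (Euc n)) (u : Euc k)
    (t : Fin k × Fin n → ℝ) : signSeminorm b T u t = T (proj b (coact t u)) := rfl

theorem signSeminorm_le {b : Fin m → Euc n} (hb : Orthonormal ℝ b) {T : Seminorm ℝ (Euc n)}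
    {Λ : ℝ} (hΛ : 0 ≤ Λ) (hT : ∀ x, T x ≤ Λ * ‖x‖) (u : Euc k) (t : Fin k × Fin n → ℝ) :
    signSeminorm b T u t ≤ Λ * ‖u‖ * √(∑ i, t i ^ 2) := by
  rw [signSeminorm_apply]
  calc _ ≤ Λ * ‖proj b (coact t u)‖ := hT _
    _ ≤ Λ * (√(∑ i, t i ^ 2) * ‖u‖) := by
      gcongr
      exact (norm_proj_le hb _).trans (norm_coact_le t u)
    _ = _ := by ring

theorem expect_norm_proj_coact_sq {b : Fin m → Euc n} (hb : Orthonormal ℝ b) (u : Euc k) :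
    𝔼 ε : Fin k × Fin n → Bool, signSeminorm b (normSeminorm ℝ (Euc n)) u (signVec ε) ^ 2 =
      m * ‖u‖ ^ 2 := by
  simp only [signSeminorm_apply, coe_normSeminorm]
  rw [expect_norm_map_coact_sq, sum_norm_proj_single_sq hb, mul_comm]

theorem expect_norm_proj_coact_le {b : Fin m → Euc n} (hb : Orthonormal ℝ b) (u : Euc k) :
    𝔼 ε : Fin k × Fin n → Bool, signSeminorm b (normSeminorm ℝ (Euc n)) u (signVec ε) ≤
      √m * ‖u‖ := by
  refine expect_le_of_expect_rpow_le (q := 2) (by norm_num) (fun ε => apply_nonneg _ _)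
    (by positivity) ?_
  simp only [Real.rpow_two]
  rw [expect_norm_proj_coact_sq hb, mul_pow, Real.sq_sqrt (by positivity)]

theorem normSeminorm_le_one_mul (x : Euc n) : normSeminorm ℝ (Euc n) x ≤ 1 * ‖x‖ := by
  simp

theorem le_expect_norm_proj_coact {b : Fin m → Euc n} (hb : Orthonormal ℝ b) (hm : 22 ≤ m)
    {u : Euc k} (hu : u ≠ 0) :
    9 / 10 * √m * ‖u‖ ≤
      𝔼 ε : Fin k × Fin n → Bool, signSeminorm b (normSeminorm ℝ (Euc n)) u (signVec ε) := by
  have hu' : 0 < ‖u‖ := norm_pos_iff.2 hu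
  have h := expect_sq_le (signSeminorm b (normSeminorm ℝ (Euc n)) u)
    (signSeminorm_le hb zero_le_one normSeminorm_le_one_mul u) (by linarith)
  rw [expect_norm_proj_coact_sq hb, one_mul] at h
  refine abs_le_of_sq_le_sq' ?_ (expect_nonneg fun ε _ => apply_nonneg _ _) |>.2
  rw [mul_pow, mul_pow, Real.sq_sqrt (by positivity)]
  have hm' : (22 : ℝ) ≤ m := by exact_mod_cast hm
  nlinarith [sq_nonneg ‖u‖]

theorem Pr_signSeminorm_gt_le {b : Fin m → Euc n} (hb : Orthonormal ℝ b) {T : Seminorm ℝ (Euc n)}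
    {Λ τ s : ℝ} (hΛ : 0 < Λ) (hτ : 0 ≤ τ) (hs : 0 ≤ s) (hT : ∀ x, T x ≤ Λ * ‖x‖) {u : Euc k}
    (hu : ‖u‖ ≤ 1)
    (hμ : 𝔼 ε : Fin k × Fin n → Bool, signSeminorm b T u (signVec ε) ≤ τ * ‖u‖) :
    Pr {ε : Fin k × Fin n → Bool | τ + s < signSeminorm b T u (signVec ε)} ≤
      Real.exp (-(s ^ 2 / (8 * Λ ^ 2))) := by
  refine Pr_upper_tail _ (fun t => (signSeminorm_le hb hΛ.le hT u t).trans ?_) hΛ hs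
    (hμ.trans (mul_le_of_le_one_right hτ hu))
  gcongr
  exact mul_le_of_le_one_right hΛ.le hu

theorem Pr_norm_proj_coact_lt_le {b : Fin m → Euc n} (hb : Orthonormal ℝ b) (hm : 22 ≤ m)
    (u : Euc k) :
    Pr {ε : Fin k × Fin n → Bool |
      signSeminorm b (normSeminorm ℝ (Euc n)) u (signVec ε) < 1 / 2 * √m * ‖u‖} ≤
      Real.exp (-(m / 50)) := by
  rcases eq_or_ne u 0 with rfl | hu
  · refine (Pr_le_expect (h := fun _ => 0) (by simp) ?_).trans ?_
    · intro ε hε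
      have h : signSeminorm b (normSeminorm ℝ (Euc n)) (0 : Euc k) (signVec ε) < 0 := by
        simpa using hε
      exact absurd h (apply_nonneg _ _).not_gt
    · rw [Fintype.expect_const]
      positivity
  have hu' : 0 < ‖u‖ := norm_pos_iff.2 hu
  have h := Pr_lower_tail (signSeminorm b (normSeminorm ℝ (Euc n)) u)
    (signSeminorm_le hb zero_le_one normSeminorm_le_one_mul u) (by linarith)
    (s := 2 / 5 * √m * ‖u‖) (by positivity) (le_expect_norm_proj_coact hb hm hu)
  refine (Pr_mono ?_).trans (h.trans (le_of_eq ?_))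
  · intro ε hε
    have hε' : signSeminorm b (normSeminorm ℝ (Euc n)) u (signVec ε) < 1 / 2 * √m * ‖u‖ := hε
    exact hε'.trans_eq (by ring)
  · congr 2
    rw [mul_pow, mul_pow, Real.sq_sqrt (by positivity)]
    field_simp
    norm_num

theorem notMem_badSigns {b : Fin m → Euc n} {T : Seminorm ℝ (Euc n)} {τ : ℝ}
    {ε : Fin k × Fin n → Bool} {N₁ N₄ : Finset (Euc k)}
    (hN₁ : ∀ x : Euc k, ‖x‖ ≤ 1 → ∃ c ∈ N₁, ‖x - c‖ ≤ 1 / 2)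
    (hN₄ : ∀ x : Euc k, ‖x‖ ≤ 1 → ∃ c ∈ N₄, ‖x - c‖ ≤ (1 / 2 : ℝ) ^ 4)
    (h₁ : ∀ c ∈ N₁, signSeminorm b (normSeminorm ℝ (Euc n)) c (signVec ε) ≤ 3 / 2 * √m)
    (h₂ : ∀ c ∈ N₄, 1 / 2 * √m * ‖c‖ ≤ signSeminorm b (normSeminorm ℝ (Euc n)) c (signVec ε))
    (h₃ : ∀ c ∈ N₁, signSeminorm b T c (signVec ε) ≤ τ) : ε ∉ badSigns b T τ := by
  simp only [signSeminorm_apply, coe_normSeminorm] at h₁ h₂ h₃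
  refine not_not.2 ⟨fun u => ?_, fun u => ?_⟩
  · have hup : ∀ v : Euc k, ‖proj b (coact (signVec ε) v)‖ ≤ 3 * √m * ‖v‖ := fun v => by
      have := seminorm_le_of_net ((normSeminorm ℝ (Euc n)).comp (proj b ∘ₗ coact (signVec ε)))
        hN₁ h₁ v
      calc _ ≤ 2 * (3 / 2 * √m) * ‖v‖ := this
        _ = _ := by ring
    rcases eq_or_ne u 0 with rfl | hu
    · simp
    have hu' : 0 < ‖u‖ := norm_pos_iff.2 hu
    set v := ‖u‖⁻¹ • u with hv
    have hv1 : ‖v‖ = 1 := by rw [hv, norm_smul, norm_inv, norm_norm, inv_mul_cancel₀ hu'.ne']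
    have huv : u = ‖u‖ • v := by rw [hv, smul_inv_smul₀ hu'.ne']
    obtain ⟨c, hc, hvc⟩ := hN₄ v hv1.le
    have e1 := hup (v - c)
    have e2 := h₂ c hc
    have e3 : 15 / 16 ≤ ‖c‖ := by
      have := norm_sub_norm_le v c
      norm_num at hvc
      linarith
    have e4 := norm_sub_norm_le (proj b (coact (signVec ε) c)) (proj b (coact (signVec ε) v))
    rw [← map_sub, ← map_sub, ← neg_sub v c, map_neg, map_neg, norm_neg] at e4
    have hs : 0 ≤ √(m : ℝ) := Real.sqrt_nonneg _
    have e5 : 3 * √m * ‖v - c‖ ≤ 3 * √m * (1 / 2) ^ 4 := by gcongr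
    have e6 : 1 / 2 * √m * (15 / 16) ≤ 1 / 2 * √m * ‖c‖ := by gcongr
    have e7 : 1 / 4 * √m ≤ ‖proj b (coact (signVec ε) v)‖ := by
      norm_num at e5
      linarith
    have e8 : ‖proj b (coact (signVec ε) u)‖ = ‖u‖ * ‖proj b (coact (signVec ε) v)‖ := by
      conv_lhs => rw [huv]
      rw [map_smul, map_smul, norm_smul, norm_norm]
    rw [e8, mul_comm]
    gcongr
  · exact seminorm_le_of_net (T.comp (proj b ∘ₗ coact (signVec ε))) hN₁ h₃ u

theorem Pr_badSigns_le {b : Fin m → Euc n} (hb : Orthonormal ℝ b) (hm : 22 ≤ m)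
    {T : Seminorm ℝ (Euc n)} {Λ τ : ℝ} (hΛ : 0 < Λ) (hτ : 0 ≤ τ) (hT : ∀ x, T x ≤ Λ * ‖x‖)
    (hμ : ∀ u : Euc k, 𝔼 ε : Fin k × Fin n → Bool, signSeminorm b T u (signVec ε) ≤ τ / 2 * ‖u‖) :
    Pr (badSigns b T τ : Set (Fin k × Fin n → Bool)) ≤
      5 ^ k * Real.exp (-(m / 32)) + 5 ^ (4 * k) * Real.exp (-(m / 50)) +
        5 ^ k * Real.exp (-(τ ^ 2 / (32 * Λ ^ 2))) := by
  obtain ⟨N₁, hN₁c, hN₁b, hN₁⟩ := exists_half_net (E := Euc k)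
  obtain ⟨N₄, hN₄c, -, hN₄⟩ := exists_dyadic_net (E := Euc k) 4
  rw [finrank_euclideanSpace_fin] at hN₁c hN₄c
  let s₁ : Euc k → Set (Fin k × Fin n → Bool) := fun c =>
    {ε | √m + √m / 2 < signSeminorm b (normSeminorm ℝ (Euc n)) c (signVec ε)}
  let s₂ : Euc k → Set (Fin k × Fin n → Bool) := fun c =>
    {ε | signSeminorm b (normSeminorm ℝ (Euc n)) c (signVec ε) < 1 / 2 * √m * ‖c‖}
  let s₃ : Euc k → Set (Fin k × Fin n → Bool) := fun c =>
    {ε | τ / 2 + τ / 2 < signSeminorm b T c (signVec ε)}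
  have hsub : (badSigns b T τ : Set (Fin k × Fin n → Bool)) ⊆
      ((⋃ c ∈ N₁, s₁ c) ∪ ⋃ c ∈ N₄, s₂ c) ∪ ⋃ c ∈ N₁, s₃ c := by
    intro ε hε
    by_contra hcon
    simp only [Set.mem_union, Set.mem_iUnion, not_or, not_exists, exists_prop, not_and] at hcon
    refine notMem_badSigns hN₁ hN₄ (fun c hc => ?_) (fun c hc => ?_) (fun c hc => ?_) hε
    · refine (not_lt.1 (hcon.1.1 c hc)).trans (le_of_eq (by ring))
    · exact not_lt.1 (hcon.1.2 c hc)
    · refine (not_lt.1 (hcon.2 c hc)).trans (le_of_eq (by ring))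
  have union : ∀ (N : Finset (Euc k)) (s : Euc k → Set (Fin k × Fin n → Bool)) (M : ℕ) (x : ℝ),
      0 ≤ x → #N ≤ M → (∀ c ∈ N, Pr (s c) ≤ x) → Pr (⋃ c ∈ N, s c) ≤ M * x := by
    intro N s M x hx hM h
    calc _ ≤ ∑ c ∈ N, Pr (s c) := Pr_iUnion_le _ _
      _ ≤ ∑ c ∈ N, x := sum_le_sum h
      _ = #N * x := by simp
      _ ≤ M * x := by gcongr
  refine (Pr_mono hsub).trans ((Pr_union_le _ _).trans (add_le_add
    ((Pr_union_le _ _).trans (add_le_add ?_ ?_)) ?_))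
  · refine (union N₁ s₁ _ _ (Real.exp_nonneg _) hN₁c fun c hc => ?_).trans (by push_cast; rfl)
    refine (Pr_signSeminorm_gt_le hb zero_lt_one (Real.sqrt_nonneg _) (by positivity)
      normSeminorm_le_one_mul (hN₁b c hc) (expect_norm_proj_coact_le hb c)).trans (le_of_eq ?_)
    congr 2
    rw [div_pow, Real.sq_sqrt (by positivity)]
    ring
  · exact (union N₄ s₂ _ _ (Real.exp_nonneg _) hN₄c fun c _ =>
      Pr_norm_proj_coact_lt_le hb hm c).trans (by push_cast; rfl)
  · refine (union N₁ s₃ _ _ (Real.exp_nonneg _) hN₁c fun c hc => ?_).trans (by push_cast; rfl)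
    refine (Pr_signSeminorm_gt_le hb hΛ (by positivity) (by positivity) hT (hN₁b c hc)
      (hμ c)).trans (le_of_eq ?_)
    congr 2
    field_simp
    ring

end BadSigns

section Family

variable {n m k N : ℕ} {q : ℝ} (hq : 1 ≤ q)

/-- The `ℓ_q` sum over `S` of the seminorms given by a family of sign matrices. -/
noncomputable def famSeminorm (ω : Fin N → Fin k × Fin n → Bool) (S : Finset (Fin N)) :
    Seminorm ℝ (Euc n) :=
  lqSeminorm hq S fun i => (normSeminorm ℝ (Euc k)).comp (act (signVec (ω i)))

theorem famSeminorm_rpow (ω : Fin N → Fin k × Fin n → Bool) (S : Finset (Fin N)) (x : Euc n) :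
    famSeminorm hq ω S x ^ q = ∑ i ∈ S, ‖act (signVec (ω i)) x‖ ^ q :=
  lqSeminorm_rpow _ _ _ _

theorem famSeminorm_update (ω : Fin N → Fin k × Fin n → Bool) {S : Finset (Fin N)} {j : Fin N}
    (hj : j ∉ S) (ε : Fin k × Fin n → Bool) :
    famSeminorm hq (Function.update ω j ε) S = famSeminorm hq ω S := by
  ext x
  change (∑ i ∈ S, ‖act (signVec (Function.update ω j ε i)) x‖ ^ q) ^ (1 / q) =
    (∑ i ∈ S, ‖act (signVec (ω i)) x‖ ^ q) ^ (1 / q)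
  congr 1
  refine sum_congr rfl fun i hi => ?_
  simp only [Function.update_of_ne (ne_of_mem_of_not_mem hi hj)]

theorem famSeminorm_mono (ω : Fin N → Fin k × Fin n → Bool) {S S' : Finset (Fin N)}
    (h : S ⊆ S') (x : Euc n) : famSeminorm hq ω S x ≤ famSeminorm hq ω S' x := by
  refine lqSeminorm_le hq S _ (apply_nonneg _ _) ?_
  rw [famSeminorm_rpow]
  exact sum_le_sum_of_subset_of_nonneg h fun i _ _ => by positivity

theorem sum_le_rpow_of_le {ι : Type*} (S : Finset ι) {a : ι → ℝ} {D : ℝ} {M : ℕ} (hD : 0 ≤ D)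
    (hS : #S ≤ M) (hq : 1 ≤ q) (h : ∀ i ∈ S, a i ≤ D ^ q) :
    ∑ i ∈ S, a i ≤ ((M : ℝ) ^ (1 / q) * D) ^ q := by
  rw [Real.mul_rpow (by positivity) hD, ← Real.rpow_mul (by positivity),
    one_div_mul_cancel (by linarith), Real.rpow_one]
  calc _ ≤ ∑ i ∈ S, D ^ q := sum_le_sum h
    _ = #S * D ^ q := by simp
    _ ≤ _ := by gcongr

theorem expect_signSeminorm_famSeminorm_le {b : Fin m → Euc n} (hb : Orthonormal ℝ b)
    (ω : Fin N → Fin k × Fin n → Bool) (S : Finset (Fin N)) (u : Euc k) :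
    𝔼 ε : Fin k × Fin n → Bool, signSeminorm b (famSeminorm hq ω S) u (signVec ε) ≤
      Real.exp 3 * √q * (N : ℝ) ^ (1 / q) * √(k * n) * ‖u‖ := by
  refine expect_le_of_expect_rpow_le hq (fun ε => apply_nonneg _ _) (by positivity) ?_
  simp only [signSeminorm_apply, famSeminorm_rpow]
  rw [expect_sum_comm]
  refine (sum_le_rpow_of_le S (D := Real.exp 3 * √q * (√(k * n) * ‖u‖)) (M := N) (by positivity)
    (by simpa using card_le_univ S) hq fun i _ => ?_).trans (le_of_eq (by ring_nf))
  refine expect_rpow_le ((normSeminorm ℝ (Euc k)).comp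
    (act (signVec (ω i)) ∘ₗ proj b ∘ₗ coact.flip u)) hq (by positivity) ?_
  have h := expect_norm_map_coact_sq (act (signVec (ω i)) ∘ₗ proj b) u
  simp only [LinearMap.comp_apply] at h
  refine h.le.trans ?_
  rw [mul_pow, Real.sq_sqrt (by positivity), mul_comm]
  gcongr
  exact sum_norm_act_proj_single_sq_le hb (ω i)

/-- The joint seminorm of all the entries of a family of matrices. -/
noncomputable def entrySeminorm (N : ℕ) (c : Euc n) :
    Seminorm ℝ (Fin N × (Fin k × Fin n) → ℝ) :=
  lqSeminorm hq univ fun i => (normSeminorm ℝ (Euc k)).comp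
    (act.flip c ∘ₗ LinearMap.funLeft ℝ ℝ (Prod.mk i))

theorem entrySeminorm_le (hq2 : 2 ≤ q) {c : Euc n} (hc : ‖c‖ ≤ 1)
    (t : Fin N × (Fin k × Fin n) → ℝ) :
    entrySeminorm hq N c t ≤ 1 * √(∑ i, t i ^ 2) := by
  rw [one_mul]
  refine (lqSeminorm_le_sqrt hq univ _ hq2 t).trans (Real.sqrt_le_sqrt ?_)
  rw [Fintype.sum_prod_type]
  refine sum_le_sum fun i _ => ?_
  have h := norm_act_le (fun p => t (i, p)) c
  have h' : ‖act (fun p => t (i, p)) c‖ ≤ √(∑ p, t (i, p) ^ 2) :=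
    h.trans (mul_le_of_le_one_right (Real.sqrt_nonneg _) hc)
  calc _ = ‖act (fun p => t (i, p)) c‖ ^ 2 := rfl
    _ ≤ √(∑ p, t (i, p) ^ 2) ^ 2 := by gcongr
    _ = _ := Real.sq_sqrt (by positivity)

theorem expect_eval {ι X : Type*} [Fintype ι] [DecidableEq ι] [Fintype X] [Nonempty X]
    (g : X → ℝ) (j : ι) : 𝔼 ω : ι → X, g (ω j) = 𝔼 x, g x := by
  rw [expect_update _ j]
  simp only [Function.update_self]
  exact Fintype.expect_const _

theorem expect_famSeminorm_univ_le {c : Euc n} (hc : ‖c‖ ≤ 1) :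
    𝔼 ω : Fin N → Fin k × Fin n → Bool, famSeminorm hq ω univ c ≤
      Real.exp 3 * √q * (N : ℝ) ^ (1 / q) * √k := by
  refine expect_le_of_expect_rpow_le hq (fun ω => apply_nonneg _ _) (by positivity) ?_
  simp only [famSeminorm_rpow]
  rw [expect_sum_comm]
  refine (sum_le_rpow_of_le univ (D := Real.exp 3 * √q * √k) (M := N) (by positivity)
    (by simp) hq fun i _ => ?_).trans (le_of_eq (by ring_nf))
  rw [expect_eval (fun x => ‖act (signVec x) c‖ ^ q) i]
  refine expect_rpow_le ((normSeminorm ℝ (Euc k)).comp (act.flip c)) hq (by positivity) ?_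
  refine (expect_norm_act_sq c).le.trans ?_
  rw [Real.sq_sqrt (by positivity)]
  exact mul_le_of_le_one_right (by positivity) (pow_le_one₀ (norm_nonneg _) hc)

theorem Pr_exists_famSeminorm_gt_le (hq2 : 2 ≤ q) (hn : 0 < n)
    (h : Real.exp 3 * √q * (N : ℝ) ^ (1 / q) * √k ≤ √n) :
    Pr {ω : Fin N → Fin k × Fin n → Bool | ¬ ∀ x, famSeminorm hq ω univ x ≤ 22 * √n * ‖x‖} ≤
      Real.exp (-10) := by
  obtain ⟨A, hAc, hAb, hA⟩ := exists_half_net (E := Euc n)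
  rw [finrank_euclideanSpace_fin] at hAc
  let s : Euc n → Set (Fin N → Fin k × Fin n → Bool) := fun c =>
    {ω | √n + 10 * √n < famSeminorm hq ω univ c}
  have hsub : {ω : Fin N → Fin k × Fin n → Bool |
      ¬ ∀ x, famSeminorm hq ω univ x ≤ 22 * √n * ‖x‖} ⊆ ⋃ c ∈ A, s c := by
    intro ω hω
    by_contra hcon
    simp only [Set.mem_iUnion, not_exists, exists_prop, not_and] at hcon
    refine hω fun x => ?_
    refine (seminorm_le_of_net _ hA (fun c hc => not_lt.1 (hcon c hc)) x).trans (le_of_eq ?_)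
    ring
  have hs : ∀ c ∈ A, Pr (s c) ≤ Real.exp (-(100 * n / 8)) := by
    intro c hc
    have h1 := Pr_upper_tail (entrySeminorm (k := k) hq N c) (entrySeminorm_le hq hq2 (hAb c hc))
      one_pos (s := 10 * √n) (by positivity) (μ := √n) ?_
    · rw [mul_pow, Real.sq_sqrt (by positivity)] at h1
      rw [← Pr_equiv (Equiv.curry (Fin N) (Fin k × Fin n) Bool).symm] at h1
      refine Eq.trans_le ?_ (h1.trans (le_of_eq (by norm_num)))
      rfl
    · refine le_trans (le_of_eq ?_) ((expect_famSeminorm_univ_le hq (hAb c hc)).trans h)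
      exact Fintype.expect_equiv (Equiv.curry (Fin N) (Fin k × Fin n) Bool) _ _ fun _ => rfl
  have h5 : (5 : ℝ) ≤ Real.exp 2 := by
    have := Real.exp_one_gt_d9
    rw [show (2 : ℝ) = 1 + 1 by norm_num, Real.exp_add]
    nlinarith
  have hn1 : (1 : ℝ) ≤ n := by exact_mod_cast hn
  calc _ ≤ ∑ c ∈ A, Pr (s c) := (Pr_mono hsub).trans (Pr_iUnion_le _ _)
    _ ≤ ∑ c ∈ A, Real.exp (-(100 * n / 8)) := sum_le_sum hs
    _ = #A * Real.exp (-(100 * n / 8)) := by simp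
    _ ≤ (5 ^ n : ℕ) * Real.exp (-(100 * n / 8)) := by gcongr
    _ ≤ Real.exp 2 ^ n * Real.exp (-(100 * n / 8)) := by push_cast; gcongr
    _ = Real.exp (2 * n - 100 * n / 8) := by
      rw [← Real.exp_nat_mul, ← Real.exp_add]; congr 1; ring
    _ ≤ Real.exp (-10) := Real.exp_le_exp.2 (by linarith)

end Family

section Selection

variable {n m k N : ℕ} {q : ℝ}

/-- `j` is a good index for the family `ω` and the subspace spanned by `b`. -/
def IsGoodIndex (hq : 1 ≤ q) (ω : Fin N → Fin k × Fin n → Bool) (b : Fin m → Euc n) (τ : ℝ)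
    (j : Fin N) : Prop :=
  ∀ u : Euc k, 1 / 4 * √m * ‖u‖ ≤ ‖proj b (coact (signVec (ω j)) u)‖ ∧
    famSeminorm hq ω (univ.erase j) (proj b (coact (signVec (ω j)) u)) ≤ 4 * τ * ‖u‖

/-- If no index is good then many indices are bad with respect to one splitting. -/
theorem exists_splitting_of_not_isGoodIndex (hq : 1 ≤ q) {ω : Fin N → Fin k × Fin n → Bool}
    {b : Fin m → Euc n} {τ : ℝ} (hτ : 0 ≤ τ) (h : ∀ j, ¬ IsGoodIndex hq ω b τ j) :
    ∃ (s : Fin N → Bool) (J : Finset (Fin N)), (∀ j ∈ J, s j = true) ∧ N ≤ 4 * #J ∧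
      ∀ j ∈ J, ω j ∈ badSigns b (famSeminorm hq ω (univ.filter fun i => s i = false)) τ := by
  suffices hW : ∀ (j : Fin N) (s : Fin N → Bool),
      ω j ∈ badSigns b (famSeminorm hq ω
        (univ.filter fun i => Function.update s j true i = false)) τ ∨
      ω j ∈ badSigns b (famSeminorm hq ω
        (univ.filter fun i => Function.update (fun i => !s i) j true i = false)) τ by
    obtain ⟨s, J, hJ, hcard⟩ := exists_splitting (fun j (s : Fin N → Bool) =>
      ω j ∈ badSigns b (famSeminorm hq ω (univ.filter fun i => s i = false)) τ) hW
    exact ⟨s, J, fun j hj => (hJ j hj).1, by simpa using hcard, fun j hj => (hJ j hj).2⟩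
  intro j s
  by_contra! hcon
  have h1 := not_not.1 hcon.1
  have h2 := not_not.1 hcon.2
  refine h j fun u => ⟨h1.1 u, ?_⟩
  have e1 := h1.2 u
  have e2 := h2.2 u
  set x := proj b (coact (signVec (ω j)) u)
  set S₁ := univ.filter fun i => Function.update s j true i = false with hS₁
  set S₂ := univ.filter fun i => Function.update (fun i => !s i) j true i = false with hS₂
  have hS : univ.erase j = S₁ ∪ S₂ := by
    ext i
    simp only [hS₁, hS₂, mem_erase, mem_univ, and_true, mem_union, mem_filter, true_and,
      Function.update_apply]
    by_cases hij : i = j <;> simp [hij]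
  have hdisj : Disjoint S₁ S₂ := by
    refine disjoint_left.2 fun i hi hi' => ?_
    simp only [hS₁, hS₂, mem_filter, mem_univ, true_and, Function.update_apply] at hi hi'
    by_cases hij : i = j
    · simp [hij] at hi
    · simp [hij] at hi hi'
      simp [hi] at hi'
  have hu : 0 ≤ 2 * τ * ‖u‖ := by positivity
  refine lqSeminorm_le hq _ _ (by positivity) ?_
  have e1' := Real.rpow_le_rpow (apply_nonneg _ _) e1 (by linarith : 0 ≤ q)
  have e2' := Real.rpow_le_rpow (apply_nonneg _ _) e2 (by linarith : 0 ≤ q)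
  rw [famSeminorm_rpow] at e1' e2'
  have h2q : (2 : ℝ) ≤ 2 ^ q := by
    simpa using Real.rpow_le_rpow_of_exponent_le (one_le_two) hq
  have hpos : 0 ≤ (2 * τ * ‖u‖) ^ q := by positivity
  calc _ = ∑ i ∈ S₁, ‖act (signVec (ω i)) x‖ ^ q + ∑ i ∈ S₂, ‖act (signVec (ω i)) x‖ ^ q := by
        rw [hS, sum_union hdisj]; rfl
    _ ≤ 2 * (2 * τ * ‖u‖) ^ q := by linarith
    _ ≤ 2 ^ q * (2 * τ * ‖u‖) ^ q := by gcongr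
    _ = (4 * τ * ‖u‖) ^ q := by
      rw [← Real.mul_rpow (by norm_num) hu]
      congr 1
      ring

theorem Pr_forall_mem_badSigns_le (hq : 1 ≤ q) {b : Fin m → Euc n} (hb : Orthonormal ℝ b)
    (hm : 22 ≤ m) {Λ τ δ : ℝ} (hΛ : 0 < Λ) (hτ : 0 ≤ τ)
    (hμ : Real.exp 3 * √q * (N : ℝ) ^ (1 / q) * √(k * n) ≤ τ / 2)
    (hδ : 5 ^ k * Real.exp (-(m / 32)) + 5 ^ (4 * k) * Real.exp (-(m / 50)) +
        5 ^ k * Real.exp (-(τ ^ 2 / (32 * Λ ^ 2))) ≤ δ)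
    {S J : Finset (Fin N)} (hSJ : ∀ j ∈ J, j ∉ S) :
    Pr {ω : Fin N → Fin k × Fin n → Bool | (∀ x, famSeminorm hq ω S x ≤ Λ * ‖x‖) ∧
      ∀ j ∈ J, ω j ∈ badSigns b (famSeminorm hq ω S) τ} ≤ δ ^ #J := by
  refine Pr_forall_mem_le (Q := fun ω => ∀ x, famSeminorm hq ω S x ≤ Λ * ‖x‖)
    (R := fun ω ε => ε ∈ badSigns b (famSeminorm hq ω S) τ) (le_trans (by positivity) hδ)
    (fun ω hω => (Pr_badSigns_le hb hm hΛ hτ hω fun u => ?_).trans hδ) J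
    (fun ω j hj ε => by rw [famSeminorm_update hq ω (hSJ j hj)])
    (fun ω j hj ε η => by rw [famSeminorm_update hq ω (hSJ j hj)])
  exact (expect_signSeminorm_famSeminorm_le hq hb ω S u).trans (by gcongr)

theorem exists_good_family (hq : 1 ≤ q) (hq2 : 2 ≤ q) (hn : 0 < n) (hm : 22 ≤ m)
    {B : Finset (Fin m → Euc n)} (hB : ∀ b ∈ B, Orthonormal ℝ b) {τ δ : ℝ} (hτ : 0 ≤ τ)
    (hμ : Real.exp 3 * √q * (N : ℝ) ^ (1 / q) * √(k * n) ≤ τ / 2)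
    (hμ' : Real.exp 3 * √q * (N : ℝ) ^ (1 / q) * √k ≤ √n)
    (hδ : 5 ^ k * Real.exp (-(m / 32)) + 5 ^ (4 * k) * Real.exp (-(m / 50)) +
        5 ^ k * Real.exp (-(τ ^ 2 / (32 * (22 * √n) ^ 2))) ≤ δ)
    (hcount : ∀ j : ℕ, N ≤ 4 * j → #B * (2 ^ N * 2 ^ N) * δ ^ j ≤ 1 / 2) :
    ∃ ω : Fin N → Fin k × Fin n → Bool, (∀ x, famSeminorm hq ω univ x ≤ 22 * √n * ‖x‖) ∧
      ∀ b ∈ B, ∃ j, IsGoodIndex hq ω b τ j := by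
  have hΛ : 0 < 22 * √(n : ℝ) := by positivity
  let I : Finset ((Fin N → Bool) × Finset (Fin N)) :=
    univ.filter fun p => (∀ j ∈ p.2, p.1 j = true) ∧ N ≤ 4 * #p.2
  let Sof : (Fin N → Bool) → Finset (Fin N) := fun s => univ.filter fun i => s i = false
  let E₀ : Set (Fin N → Fin k × Fin n → Bool) :=
    {ω | ¬ ∀ x, famSeminorm hq ω univ x ≤ 22 * √n * ‖x‖}
  let E : (Fin m → Euc n) × ((Fin N → Bool) × Finset (Fin N)) →
      Set (Fin N → Fin k × Fin n → Bool) := fun p =>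
    {ω | (∀ x, famSeminorm hq ω (Sof p.2.1) x ≤ 22 * √n * ‖x‖) ∧
      ∀ j ∈ p.2.2, ω j ∈ badSigns p.1 (famSeminorm hq ω (Sof p.2.1)) τ}
  have hcardI : (#I : ℝ) ≤ 2 ^ N * 2 ^ N := by
    have : #I ≤ 2 ^ N * 2 ^ N := by
      refine (card_filter_le _ _).trans (le_of_eq ?_)
      simp
    exact_mod_cast this
  have hE : Pr (⋃ p ∈ B ×ˢ I, E p) ≤ 1 / 2 := by
    rcases (B ×ˢ I).eq_empty_or_nonempty with hemp | hne
    · rw [hemp]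
      refine (Pr_iUnion_le _ _).trans (by simp)
    have hB0 : (0 : ℝ) < #B := by
      exact_mod_cast card_pos.2 (nonempty_product.1 hne).1
    have hD : (0 : ℝ) < #B * (2 ^ N * 2 ^ N) := by positivity
    calc _ ≤ ∑ p ∈ B ×ˢ I, Pr (E p) := Pr_iUnion_le _ _
      _ ≤ ∑ p ∈ B ×ˢ I, (1 / 2) / (#B * (2 ^ N * 2 ^ N) : ℝ) := sum_le_sum fun p hp => by
          obtain ⟨hp1, hp2⟩ := mem_product.1 hp
          obtain ⟨hp3, hp4⟩ := (mem_filter.1 hp2).2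
          refine (Pr_forall_mem_badSigns_le hq (hB _ hp1) hm hΛ hτ hμ hδ
            (fun j hj => by simp [Sof, hp3 j hj])).trans ?_
          rw [le_div_iff₀' hD]
          exact hcount _ hp4
      _ = (#B * #I) * ((1 / 2) / (#B * (2 ^ N * 2 ^ N) : ℝ)) := by simp [card_product]
      _ ≤ (#B * (2 ^ N * 2 ^ N)) * ((1 / 2) / (#B * (2 ^ N * 2 ^ N) : ℝ)) := by gcongr
      _ = 1 / 2 := by field_simp
  have h0 : Pr E₀ ≤ Real.exp (-10) := Pr_exists_famSeminorm_gt_le hq hq2 hn hμ'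
  have hexp : Real.exp (-10) < 1 / 2 := by
    rw [Real.exp_neg, inv_lt_comm₀ (Real.exp_pos _) (by norm_num)]
    linarith [Real.add_one_le_exp (10 : ℝ)]
  obtain ⟨ω, hω⟩ := exists_notMem_of_Pr_lt_one
    (((Pr_union_le E₀ (⋃ p ∈ B ×ˢ I, E p)).trans (add_le_add h0 hE)).trans_lt
      (by linarith : Real.exp (-10) + 1 / 2 < 1))
  simp only [Set.mem_union, not_or, Set.mem_iUnion, not_exists, exists_prop, not_and] at hω
  have hglob : ∀ x, famSeminorm hq ω univ x ≤ 22 * √n * ‖x‖ := not_not.1 hω.1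
  refine ⟨ω, hglob, fun b hb => ?_⟩
  by_contra! hcon
  obtain ⟨s, J, hJ, hcard, hbad⟩ := exists_splitting_of_not_isGoodIndex hq hτ hcon
  exact hω.2 (b, s, J) (mem_product.2 ⟨hb, mem_filter.2 ⟨mem_univ _, hJ, hcard⟩⟩)
    ⟨fun x => (famSeminorm_mono hq ω (subset_univ _) x).trans (hglob x), hbad⟩

end Selection

section Dominant

variable {n m k N : ℕ} {q : ℝ}

theorem famSeminorm_proj_sub_le (hq : 1 ≤ q) {ω : Fin N → Fin k × Fin n → Bool}
    (hω : ∀ x, famSeminorm hq ω univ x ≤ 22 * √n * ‖x‖) {b b' : Fin m → Euc n}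
    (hb : Orthonormal ℝ b) (hb' : Orthonormal ℝ b') {r : ℕ}
    (hbb' : ∀ a, ‖b a - b' a‖ ≤ 2 * (1 / 2) ^ r) (hn : 0 < n) (hmn : m ≤ n) (hkn : k ≤ n)
    (hr : 11264 * (n : ℝ) ^ 3 ≤ 2 ^ r) (S : Finset (Fin N)) (ε : Fin k × Fin n → Bool)
    (u : Euc k) :
    famSeminorm hq ω S (proj b (coact (signVec ε) u) - proj b' (coact (signVec ε) u)) ≤
      1 / 128 * ‖u‖ := by
  have hn1 : (1 : ℝ) ≤ n := by exact_mod_cast hn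
  have hmn' : (m : ℝ) ≤ n := by exact_mod_cast hmn
  have hkn' : (k : ℝ) ≤ n := by exact_mod_cast hkn
  have hsq : √(n : ℝ) ≤ n := Real.sqrt_le_iff.2 ⟨by positivity, by nlinarith⟩
  have hsq' : √((k : ℝ) * n) ≤ n := Real.sqrt_le_iff.2 ⟨by positivity, by nlinarith⟩
  calc _ ≤ 22 * √n * ‖proj b (coact (signVec ε) u) - proj b' (coact (signVec ε) u)‖ :=
        (famSeminorm_mono hq ω (subset_univ S) _).trans (hω _)
    _ ≤ 22 * √n * (2 * m * (2 * (1 / 2) ^ r) * (√(k * n) * ‖u‖)) := by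
      gcongr
      refine (norm_proj_sub_le hb hb' hbb' _).trans ?_
      gcongr
      exact norm_coact_signVec_le ε u
    _ ≤ 22 * n * (2 * n * (2 * (1 / 2) ^ r) * (n * ‖u‖)) := by gcongr
    _ = 88 * n ^ 3 / 2 ^ r * ‖u‖ := by rw [one_div, inv_pow]; ring
    _ ≤ 1 / 128 * ‖u‖ := by
      refine mul_le_mul_of_nonneg_right ?_ (norm_nonneg u)
      rw [div_le_div_iff₀ (by positivity) (by norm_num)]
      linarith

theorem five_le_exp : (5 : ℝ) ≤ Real.exp (7 / 4) := by
  have h := Real.exp_one_gt_d9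
  have h4 : Real.exp (7 / 4) ^ 4 = Real.exp 1 ^ 7 := by
    rw [← Real.exp_nat_mul, ← Real.exp_nat_mul]; norm_num
  have h7 : (5 : ℝ) ^ 4 ≤ Real.exp 1 ^ 7 :=
    calc (5 : ℝ) ^ 4 ≤ (27 / 10) ^ 7 := by norm_num
      _ ≤ _ := by gcongr; linarith
  rw [← h4] at h7
  exact le_of_pow_le_pow_left₀ (by norm_num) (Real.exp_nonneg _) h7

theorem badSigns_bound_le {p : ℝ} (hk : 0 < k) (hp : 32 * (k : ℝ) ≤ p) (hpm : p ≤ m / 50) :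
    5 ^ k * Real.exp (-(m / 32)) + 5 ^ (4 * k) * Real.exp (-(m / 50)) + 5 ^ k * Real.exp (-p) ≤
      Real.exp (-(p / 2)) := by
  have hk1 : (1 : ℝ) ≤ k := by exact_mod_cast hk
  have h5 := five_le_exp
  have h5k : (5 : ℝ) ^ (4 * k) ≤ Real.exp (7 * k) :=
    calc (5 : ℝ) ^ (4 * k) ≤ Real.exp (7 / 4) ^ (4 * k) := by gcongr
      _ = _ := by rw [← Real.exp_nat_mul]; push_cast; congr 1; ring
  have h5k' : (5 : ℝ) ^ k ≤ 5 ^ (4 * k) := pow_le_pow_right₀ (by norm_num) (by omega)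
  have e1 : Real.exp (-(m / 32 : ℝ)) ≤ Real.exp (-p) := Real.exp_le_exp.2 (by linarith)
  have e2 : Real.exp (-(m / 50 : ℝ)) ≤ Real.exp (-p) := Real.exp_le_exp.2 (by linarith)
  have h3 : (3 : ℝ) ≤ Real.exp 2 := by linarith [Real.add_one_le_exp (2 : ℝ)]
  calc _ ≤ 5 ^ (4 * k) * Real.exp (-p) + 5 ^ (4 * k) * Real.exp (-p) +
        5 ^ (4 * k) * Real.exp (-p) := by gcongr
    _ = 3 * (5 ^ (4 * k) * Real.exp (-p)) := by ring
    _ ≤ Real.exp 2 * (Real.exp (7 * k) * Real.exp (-p)) := by gcongr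
    _ = Real.exp (2 + 7 * k - p) := by rw [← Real.exp_add, ← Real.exp_add]; congr 1; ring
    _ ≤ _ := Real.exp_le_exp.2 (by linarith)

theorem net_count_le {p : ℝ} {M r j : ℕ} (hM : M ≤ 5 ^ (r * n * m)) (hp : 32 ≤ p)
    (hrnm : 4 ≤ r * n * m) (hpN : 32 * (r * n * m : ℝ) ≤ p * N) (hj : N ≤ 4 * j) :
    (M : ℝ) * (2 ^ N * 2 ^ N) * Real.exp (-(p / 2)) ^ j ≤ 1 / 2 := by
  have h5 := five_le_exp
  have hrnm' : (4 : ℝ) ≤ r * n * m := by exact_mod_cast hrnm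
  have hj' : (N : ℝ) ≤ 4 * j := by exact_mod_cast hj
  have hM' : (M : ℝ) ≤ 5 ^ (r * n * m) := by exact_mod_cast hM
  have h4 : (4 : ℝ) ≤ Real.exp 2 := by
    have := Real.exp_one_gt_d9
    rw [show (2 : ℝ) = 1 + 1 by norm_num, Real.exp_add]
    nlinarith
  have hexp : Real.exp (-1) ≤ 1 / 2 := by
    rw [Real.exp_neg, inv_le_comm₀ (Real.exp_pos _) (by norm_num)]
    linarith [Real.add_one_le_exp (1 : ℝ)]
  calc _ ≤ Real.exp (7 / 4) ^ (r * n * m) * 4 ^ N * Real.exp (-(p / 2)) ^ j := by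
        rw [← mul_pow, show (2 : ℝ) * 2 = 4 by norm_num]
        gcongr
        exact hM'.trans (by gcongr)
    _ ≤ Real.exp (7 / 4) ^ (r * n * m) * Real.exp 2 ^ N * Real.exp (-(p / 2)) ^ j := by gcongr
    _ = Real.exp (7 / 4 * (r * n * m) + 2 * N - p / 2 * j) := by
      rw [← Real.exp_nat_mul, ← Real.exp_nat_mul, ← Real.exp_nat_mul, ← Real.exp_add,
        ← Real.exp_add]
      push_cast
      congr 1
      ring
    _ ≤ Real.exp (-1) := by
      refine Real.exp_le_exp.2 ?_
      have e1 : p * N ≤ p * (4 * j) := by gcongr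
      have e2 : 32 * (N : ℝ) ≤ p * N := by gcongr
      nlinarith
    _ ≤ 1 / 2 := hexp

theorem hasDominant_of_bounds (hq : 2 < q) (hk : 0 < k) (hkn : k ≤ n) (hm : 22 ≤ m) (hmn : m ≤ n)
    {r : ℕ} {p : ℝ} (hp : p = m ^ 2 / (512 ^ 2 * 32 * 484 * (k * n)))
    (hμ : Real.exp 3 * √q * (N : ℝ) ^ (1 / q) * √(k * n) ≤ m / (512 * √k) / 2)
    (hpk : 32 * (k : ℝ) ≤ p) (hpN : 32 * (r * n * m : ℝ) ≤ p * N)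
    (hr : 11264 * (n : ℝ) ^ 3 ≤ 2 ^ r) : HasDominant q n m k := by
  have hq1 : 1 ≤ q := by linarith
  have hn : 0 < n := by omega
  have hk1 : (1 : ℝ) ≤ k := by exact_mod_cast hk
  have hn1 : (1 : ℝ) ≤ n := by exact_mod_cast hn
  have hm1 : (22 : ℝ) ≤ m := by exact_mod_cast hm
  have hmn' : (m : ℝ) ≤ n := by exact_mod_cast hmn
  have hkn' : (k : ℝ) ≤ n := by exact_mod_cast hkn
  have hsk : 1 ≤ √(k : ℝ) := Real.one_le_sqrt.2 hk1
  have hsn : 0 < √(n : ℝ) := Real.sqrt_pos.2 (by linarith)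
  set τ : ℝ := m / (512 * √k) with hτ
  have hτ0 : 0 ≤ τ := by positivity
  have hpτ : τ ^ 2 / (32 * (22 * √n) ^ 2) = p := by
    rw [hp, hτ, div_pow, mul_pow, mul_pow, Real.sq_sqrt (by positivity),
      Real.sq_sqrt (by positivity)]
    field_simp
    norm_num
  have hpm : p ≤ m / 50 := by
    rw [hp, div_le_div_iff₀ (by positivity) (by norm_num)]
    have h1 : (m : ℝ) * m ≤ m * n := by gcongr
    have h2 : (m : ℝ) * n ≤ m * (k * n) := by
      gcongr
      nlinarith
    nlinarith
  have hrpos : 1 ≤ r := by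
    by_contra! h0
    have : r = 0 := by omega
    subst this
    have : (1 : ℝ) ≤ (n : ℝ) ^ 3 := one_le_pow₀ hn1
    norm_num at hr
    linarith
  have hμ' : Real.exp 3 * √q * (N : ℝ) ^ (1 / q) * √k ≤ √n := by
    refine le_of_mul_le_mul_right ?_ hsn
    calc _ = Real.exp 3 * √q * (N : ℝ) ^ (1 / q) * √(k * n) := by
          rw [Real.sqrt_mul (by positivity)]; ring
      _ ≤ τ / 2 := hμ
      _ ≤ m := by
        rw [hτ, div_div, div_le_iff₀ (by positivity)]
        nlinarith
      _ ≤ n := hmn'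
      _ = _ := (Real.mul_self_sqrt (by positivity)).symm
  obtain ⟨B, hBc, hB, hBnet⟩ := exists_orthonormal_net n m r
  have hrnm : 4 ≤ r * n * m := by
    calc 4 ≤ 1 * 1 * 22 := by norm_num
      _ ≤ r * n * m := by gcongr; omega
  obtain ⟨ω, hω, hgood⟩ := exists_good_family (k := k) (N := N) hq1 hq.le hn hm hB hτ0 hμ hμ'
    (δ := Real.exp (-(p / 2))) (by rw [hpτ]; exact badSigns_bound_le hk hpk hpm)
    (fun j hj => net_count_le hBc (by linarith) hrnm hpN hj)
  refine ⟨N, fun i => act (signVec (ω i)), m / (32 * √k), by positivity, fun b hb => ?_⟩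
  obtain ⟨b', hb'B, hbb'⟩ := hBnet b hb
  have hb' := hB b' hb'B
  obtain ⟨j, hj⟩ := hgood b' hb'B
  refine ⟨j, proj b ∘ₗ coact (signVec (ω j)), fun u => ?_⟩
  simp only [LinearMap.comp_apply]
  have hmk : 1 ≤ m / √(k : ℝ) := by
    rw [one_le_div (by positivity)]
    refine Real.sqrt_le_iff.2 ⟨by positivity, ?_⟩
    nlinarith
  set x := proj b (coact (signVec (ω j)) u)
  set x' := proj b' (coact (signVec (ω j)) u)
  have hdiff : ∀ S, famSeminorm hq1 ω S (x - x') ≤ 1 / 128 * ‖u‖ := fun S =>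
    famSeminorm_proj_sub_le hq1 hω hb hb' hbb' hn hmn hkn hr S (ω j) u
  refine ⟨proj_mem_span _ _, ?_, ?_, ?_⟩
  · have h1 := le_norm_act_proj_coact hb' (signVec (ω j)) (by positivity) (hj u).1
    rw [mul_pow, Real.sq_sqrt (by positivity)] at h1
    have h2 : ‖act (signVec (ω j)) (x - x')‖ ≤ 1 / 128 * ‖u‖ :=
      (le_lqSeminorm hq1 univ (fun i => (normSeminorm ℝ (Euc k)).comp (act (signVec (ω i))))
        (mem_univ j) (x - x')).trans (hdiff univ)
    have h3 := norm_sub_norm_le (act (signVec (ω j)) x') (act (signVec (ω j)) x)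
    rw [← map_sub, ← neg_sub x x', map_neg, norm_neg] at h3
    have h4 : (m : ℝ) / (32 * √k) * √k = m / 32 := by field_simp
    rw [h4]
    have h5 : 1 / 128 * ‖u‖ ≤ m / 32 * ‖u‖ := by
      refine mul_le_mul_of_nonneg_right ?_ (norm_nonneg u)
      linarith
    have h6 : (1 / 4 : ℝ) ^ 2 * m * ‖u‖ = 2 * (m / 32 * ‖u‖) := by ring
    linarith
  · have h1 : famSeminorm hq1 ω (univ.erase j) x ≤ m / (32 * √k) / 2 * ‖u‖ := by
      have h2 := map_add_le_add (famSeminorm hq1 ω (univ.erase j)) x' (x - x')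
      rw [add_sub_cancel] at h2
      have h3 := (hj u).2
      have h4 := hdiff (univ.erase j)
      have h5 : 4 * τ = m / √k / 128 := by rw [hτ]; field_simp; norm_num
      have h6 : (m : ℝ) / (32 * √k) / 2 = m / √k / 64 := by field_simp; norm_num
      rw [h5] at h3
      rw [h6]
      nlinarith [norm_nonneg u]
    have h2 := Real.rpow_le_rpow (apply_nonneg _ _) h1 (by linarith : 0 ≤ q)
    rwa [famSeminorm_rpow] at h2
  · calc _ ≤ √(k * n) * ‖u‖ := (norm_proj_le hb _).trans (norm_coact_signVec_le _ u)
      _ ≤ n * ‖u‖ := by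
        gcongr
        exact Real.sqrt_le_iff.2 ⟨by positivity, by nlinarith⟩

end Dominant

section Parameters

theorem exp_three_le : Real.exp 3 ≤ 21 := by
  have h := Real.exp_one_lt_d9
  have h3 : Real.exp 3 = Real.exp 1 ^ 3 := by rw [← Real.exp_nat_mul]; norm_num
  rw [h3]
  calc Real.exp 1 ^ 3 ≤ 2.7182818286 ^ 3 := by gcongr
    _ ≤ 21 := by norm_num

/-- A number of dyadic scales which is logarithmic in `n` but beats a power of `n`. -/
theorem exists_scales {n : ℕ} (hn : 22 ≤ n) :
    ∃ r : ℕ, (r : ℝ) ≤ 30 * Real.log n ∧ 11264 * (n : ℝ) ^ 3 ≤ 2 ^ r := by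
  have hn' : (22 : ℝ) ≤ n := by exact_mod_cast hn
  have hlog : 3 ≤ Real.log n :=
    (Real.le_log_iff_exp_le (by linarith)).2 (by linarith [exp_three_le])
  refine ⟨10 * (Nat.log 2 n + 1), ?_, ?_⟩
  · have h1 : ((2 ^ Nat.log 2 n : ℕ) : ℝ) ≤ n := by
      exact_mod_cast Nat.pow_log_le_self 2 (by omega)
    have h2 := Real.log_le_log (by positivity) h1
    push_cast at h2 ⊢
    rw [Real.log_pow] at h2
    have h3 := Real.log_two_gt_d9
    have h4 : (0 : ℝ) ≤ Nat.log 2 n := by positivity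
    nlinarith
  · have h1 : (n : ℝ) ≤ 2 ^ (Nat.log 2 n + 1) := by
      exact_mod_cast (Nat.lt_pow_succ_log_self one_lt_two n).le
    calc 11264 * (n : ℝ) ^ 3 ≤ 22 ^ 7 * (n : ℝ) ^ 3 := by gcongr; norm_num
      _ ≤ (n : ℝ) ^ 7 * (n : ℝ) ^ 3 := by gcongr
      _ = (n : ℝ) ^ 10 := by ring
      _ ≤ (2 ^ (Nat.log 2 n + 1)) ^ 10 := by gcongr
      _ = _ := by rw [← pow_mul, mul_comm]

/-- The exponent balance behind the choice of the number of matrices. -/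
theorem rpow_balance {q x y k : ℝ} (hq : 2 < q) (hx : 0 < x) (hy : 0 ≤ y) (hk : 0 ≤ k) :
    x ^ 2 * k * y * (√q * k * √x) ^ q ≤
      (k * (√q * x ^ ((q / 2 + 2) / (q + 1)) * y ^ (1 / (q + 1)))) ^ (q + 1) := by
  have hsq : 1 ≤ √q := Real.one_le_sqrt.2 (by linarith)
  have e1 : (x ^ ((q / 2 + 2) / (q + 1))) ^ (q + 1) = x ^ 2 * √x ^ q := by
    rw [← Real.rpow_mul hx.le, div_mul_cancel₀ _ (by linarith), Real.sqrt_eq_rpow,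
      ← Real.rpow_mul hx.le, ← Real.rpow_natCast, ← Real.rpow_add hx]
    congr 1
    push_cast
    ring
  have e2 : (y ^ (1 / (q + 1))) ^ (q + 1) = y := by
    rw [← Real.rpow_mul hy, one_div_mul_cancel (by linarith), Real.rpow_one]
  have e3 : ∀ z : ℝ, 0 ≤ z → z ^ (q + 1) = z ^ q * z := fun z hz => by
    rw [Real.rpow_add_of_nonneg hz (by linarith) zero_le_one, Real.rpow_one]
  have hA : 0 ≤ √q * x ^ ((q / 2 + 2) / (q + 1)) := by positivity
  rw [Real.mul_rpow hk (by positivity), Real.mul_rpow hA (by positivity),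
    Real.mul_rpow (x := √q) (y := x ^ ((q / 2 + 2) / (q + 1))) (z := q + 1)
      (Real.sqrt_nonneg q) (by positivity), e1, e2, e3 k hk, e3 √q (by positivity),
    Real.mul_rpow (by positivity) (by positivity), Real.mul_rpow (by positivity) hk]
  have h0 : 0 ≤ x ^ 2 * k * y * (√q ^ q * k ^ q * √x ^ q) := by positivity
  calc _ = x ^ 2 * k * y * (√q ^ q * k ^ q * √x ^ q) * 1 := by ring
    _ ≤ x ^ 2 * k * y * (√q ^ q * k ^ q * √x ^ q) * √q := by gcongr
    _ = _ := by ring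

theorem hasDominant_of_le {q : ℝ} (hq : 2 < q) {n m k : ℕ} (hk : 0 < k) (hn : 2 ≤ n) (hmn : m ≤ n)
    (h : k * (√q * (n : ℝ) ^ ((q / 2 + 2) / (q + 1)) * Real.log n ^ (1 / (q + 1))) ≤
      1 / 10 ^ 13 * m) : HasDominant q n m k := by
  have hk1 : (1 : ℝ) ≤ k := by exact_mod_cast hk
  have hn2 : (2 : ℝ) ≤ n := by exact_mod_cast hn
  have hmn' : (m : ℝ) ≤ n := by exact_mod_cast hmn
  have hsq : 1 ≤ √q := Real.one_le_sqrt.2 (by linarith)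
  have hlog2 : 1 / 2 ≤ Real.log n := by
    have := Real.log_le_log (by norm_num) hn2
    linarith [Real.log_two_gt_d9]
  have hlogpow : 1 / 2 ≤ Real.log n ^ (1 / (q + 1)) := by
    have h1 : (1 / 2 : ℝ) ^ (1 : ℝ) ≤ (1 / 2) ^ (1 / (q + 1)) :=
      Real.rpow_le_rpow_of_exponent_ge (by norm_num) (by norm_num)
        (by rw [div_le_one (by linarith)]; linarith)
    rw [Real.rpow_one] at h1
    exact h1.trans (Real.rpow_le_rpow (by norm_num) hlog2 (by positivity))
  have hnpow : √(n : ℝ) ≤ (n : ℝ) ^ ((q / 2 + 2) / (q + 1)) := by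
    rw [Real.sqrt_eq_rpow]
    refine Real.rpow_le_rpow_of_exponent_le (by linarith) ?_
    rw [div_le_div_iff₀ (by norm_num) (by linarith)]
    linarith
  have hsn : 1 ≤ √(n : ℝ) := Real.one_le_sqrt.2 (by linarith)
  have hkn2 : k * √(n : ℝ) ≤ 2 / 10 ^ 13 * m := by
    have h1 : k * (1 * √(n : ℝ) * (1 / 2)) ≤
        k * (√q * (n : ℝ) ^ ((q / 2 + 2) / (q + 1)) * Real.log n ^ (1 / (q + 1))) := by gcongr
    linarith
  have hkm : (k : ℝ) ≤ 2 / 10 ^ 13 * m := le_trans (by nlinarith) hkn2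
  have hm22' : (22 : ℝ) ≤ m := by
    norm_num at hkm
    linarith
  have hm22 : 22 ≤ m := by exact_mod_cast hm22'
  have hm0 : (0 : ℝ) < m := by linarith
  have hkn : k ≤ n := by
    have : (k : ℝ) ≤ n := by
      norm_num at hkm
      linarith
    exact_mod_cast this
  have hn22 : 22 ≤ n := hm22.trans hmn
  have hlog : 3 ≤ Real.log n :=
    (Real.le_log_iff_exp_le (by linarith)).2 (by linarith [exp_three_le])
  obtain ⟨r, hrlog, hr⟩ := exists_scales hn22
  let K : ℝ := 960 * (512 ^ 2 * 32 * 484)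
  let v : ℝ := K * (n ^ 2 * k * Real.log n / m)
  have hv1 : 1 ≤ v := by
    have h1 : 1 ≤ (n : ℝ) ^ 2 * k * Real.log n / m := by
      rw [one_le_div hm0]
      calc (m : ℝ) ≤ n * 1 * 1 * 1 := by linarith
        _ ≤ n * n * k * Real.log n := by gcongr <;> linarith
        _ = _ := by ring
    calc (1 : ℝ) ≤ K * 1 := by norm_num [K]
      _ ≤ v := mul_le_mul_of_nonneg_left h1 (by norm_num [K])
  have hNlow : v ≤ (⌈v⌉₊ : ℝ) := Nat.le_ceil v
  have hNup : (⌈v⌉₊ : ℝ) ≤ 2 * v := by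
    linarith [Nat.ceil_lt_add_one (by linarith : 0 ≤ v)]
  refine hasDominant_of_bounds (N := ⌈v⌉₊) (r := r) hq hk hkn hm22 hmn rfl ?_ ?_ ?_ hr
  · have key : (⌈v⌉₊ : ℝ) ^ (1 / q) * (√q * k * √n) ≤ m / (1024 * 21) := by
      refine (Real.rpow_le_rpow_iff (by positivity) (by positivity) (by linarith : 0 < q)).1 ?_
      rw [Real.mul_rpow (by positivity) (by positivity), ← Real.rpow_mul (by positivity),
        one_div_mul_cancel (by linarith), Real.rpow_one]
      have hb := rpow_balance (k := k) hq (by linarith : (0 : ℝ) < n)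
        (by linarith : 0 ≤ Real.log n) (by linarith)
      calc _ ≤ 2 * v * (√q * k * √n) ^ q := by gcongr
        _ = 2 * K / m * ((n : ℝ) ^ 2 * k * Real.log n * (√q * k * √n) ^ q) := by
          simp only [v]; ring
        _ ≤ 2 * K / m * (1 / 10 ^ 13 * m) ^ (q + 1) := by
          gcongr
          exact hb.trans (by gcongr)
        _ = 2 * K / 10 ^ 13 * (1 / 10 ^ 13 * m) ^ q := by
          rw [Real.rpow_add (by positivity), Real.rpow_one]
          field_simp
        _ ≤ 1 * (m / (1024 * 21)) ^ q := by
          gcongr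
          · norm_num [K]
          · norm_num
            linarith
        _ = _ := one_mul _
    have hsk : 0 < √(k : ℝ) := by positivity
    rw [div_div, le_div_iff₀ (by positivity), Real.sqrt_mul (by positivity)]
    have hkk : √(k : ℝ) * √k = k := Real.mul_self_sqrt (by positivity)
    calc _ = 1024 * Real.exp 3 * ((⌈v⌉₊ : ℝ) ^ (1 / q) * (√q * (√k * √k) * √n)) := by ring
      _ ≤ 1024 * 21 * (m / (1024 * 21)) := by
        rw [hkk]
        gcongr
        exact exp_three_le
      _ = m := by field_simp
  · rw [le_div_iff₀ (by positivity)]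
    have h1 : (k * √(n : ℝ)) ^ 2 ≤ (2 / 10 ^ 13 * m) ^ 2 := by gcongr
    rw [mul_pow, Real.sq_sqrt (by positivity), mul_pow] at h1
    calc _ = 32 * (512 ^ 2 * 32 * 484) * ((k : ℝ) ^ 2 * n) := by ring
      _ ≤ 32 * (512 ^ 2 * 32 * 484) * ((2 / 10 ^ 13) ^ 2 * m ^ 2) := by gcongr
      _ ≤ 1 * (m : ℝ) ^ 2 := by
        rw [← mul_assoc]
        gcongr
        norm_num
      _ = _ := one_mul _
  · have h1 : (m : ℝ) ^ 2 / (512 ^ 2 * 32 * 484 * (k * n)) * v = 960 * (Real.log n * n * m) := by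
      simp only [v, K]
      field_simp
    calc _ ≤ 32 * (30 * Real.log n * n * m) := by gcongr
      _ = 960 * (Real.log n * n * m) := by ring
      _ = _ := h1.symm
      _ ≤ _ := by gcongr

end Parameters

section Euclidean

theorem cotype_ineq_euclidean {q : ℝ} (hq : 2 < q) (n M : ℕ) (x : Fin M → Euc n) :
    (∑ i, ‖x i‖ ^ q) ^ (1 / q) ≤ 1 * √(radAvg x) := by
  rw [one_mul, radAvg_eq_expect, expect_norm_sq_sum]
  have h := sum_rpow_le_sqrt_rpow hq.le univ (a := fun i => ‖x i‖) (fun i _ => norm_nonneg _)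
  calc (∑ i, ‖x i‖ ^ q) ^ (1 / q) ≤ (√(∑ i, ‖x i‖ ^ 2) ^ q) ^ (1 / q) := by gcongr
    _ = √(∑ i, ‖x i‖ ^ 2) := by
      rw [← Real.rpow_mul (Real.sqrt_nonneg _), mul_one_div_cancel (by linarith), Real.rpow_one]

end Euclidean

section ZeroDimensional

variable {Y : Type*} [SeminormedAddCommGroup Y] [NormedSpace ℝ Y]

theorem complementedIn_bot {C : ℝ} (hC : 0 ≤ C) : ComplementedIn C (⊥ : Submodule ℝ Y) :=
  ⟨0, by simp, LinearMap.range_zero, fun y => by simpa using by positivity⟩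

theorem isomorphicTo_bot {V : Type*} [NormedAddCommGroup V] [NormedSpace ℝ V]
    [FiniteDimensional ℝ V] (hV : Module.finrank ℝ V = 0) (C : ℝ) :
    IsomorphicTo C V (⊥ : Submodule ℝ Y) := by
  have : Subsingleton V := Module.finrank_zero_iff.1 hV
  refine ⟨LinearEquiv.ofSubsingleton V _, 1, one_pos, fun v => ?_⟩
  rw [Subsingleton.elim v 0]
  simp

end ZeroDimensional

end Saturation

/-- **Proposition 3.1.** Let `2 < q < ∞` and `α := (q-2)/(2q+2)`.  There is a universal
constant `c₁ > 0` and, for every `Γ ≥ 1`, a constant `C' = C'(q,Γ)` such that whenever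
`√q n^{1-α} (log n)^{(1-2α)/3} ≤ m₀ ≤ n` and `V` is a normed space with `C_q(V) ≤ Γ` and
`dim V ≤ c₁ m₀ / (q^{1/2} n^{1-α} (log n)^{(1-2α)/3})`, there is an `n`-dimensional normed
space `Y` with `C_q(Y) ≤ C'` such that for every `m₀ ≤ m ≤ n`, every `m`-dimensional
subspace of `Y` contains a `2^{1/q}`-complemented subspace `2^{1/q}`-isomorphic to `V`. -/
theorem saturation_with_cotype_technical :
    ∃ c₁ : ℝ, 0 < c₁ ∧
    ∀ q : ℝ, 2 < q →
    ∀ Γ : ℝ, 1 ≤ Γ →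
    ∃ C' : ℝ,
    ∀ n m₀ : ℕ, 0 < n → 0 < m₀ →
      Real.sqrt q * (n : ℝ) ^ (1 - (q - 2) / (2 * q + 2)) *
        (Real.log n) ^ ((1 - 2 * ((q - 2) / (2 * q + 2))) / 3) ≤ (m₀ : ℝ) →
      m₀ ≤ n →
    ∀ (V : Type) (_ : NormedAddCommGroup V) (_ : NormedSpace ℝ V), FiniteDimensional ℝ V →
      cotypeConst q V ≤ Γ →
      (Module.finrank ℝ V : ℝ) ≤
        c₁ * (m₀ : ℝ) / (Real.sqrt q * (n : ℝ) ^ (1 - (q - 2) / (2 * q + 2)) *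
          (Real.log n) ^ ((1 - 2 * ((q - 2) / (2 * q + 2))) / 3)) →
    ∃ (Y : Type) (_ : NormedAddCommGroup Y) (_ : NormedSpace ℝ Y),
      Module.finrank ℝ Y = n ∧ cotypeConst q Y ≤ C' ∧
      ∀ m : ℕ, m₀ ≤ m → m ≤ n →
      ∀ Ysub : Submodule ℝ Y, Module.finrank ℝ Ysub = m →
      ∃ E : Submodule ℝ Ysub,
        ComplementedIn ((2:ℝ) ^ (1/q)) E ∧ IsomorphicTo ((2:ℝ) ^ (1/q)) V E := by
  refine ⟨1 / 10 ^ 13, by norm_num, fun q hq Γ hΓ => ⟨2 * Γ * (Real.exp 3 * √q), ?_⟩⟩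
  intro n m₀ hn _ _ hmn V _ _ _ hVΓ hdim
  have hsq : 1 ≤ √q := Real.one_le_sqrt.2 (by linarith)
  rcases Nat.eq_zero_or_pos (Module.finrank ℝ V) with hk | hk
  · have hC : (1 : ℝ) ≤ 2 * Γ * (Real.exp 3 * √q) := by
      have h1 : 1 ≤ Real.exp 3 * √q :=
        one_le_mul_of_one_le_of_one_le (Real.one_le_exp (by norm_num)) hsq
      exact one_le_mul_of_one_le_of_one_le (by linarith) h1
    refine ⟨Saturation.Euc n, inferInstance, inferInstance, finrank_euclideanSpace_fin,
      (Saturation.cotypeConst_le zero_le_one (Saturation.cotype_ineq_euclidean hq n)).trans hC, ?_⟩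
    intro m _ _ Ysub _
    exact ⟨⊥, Saturation.complementedIn_bot (by positivity),
      Saturation.isomorphicTo_bot hk _⟩
  · have e1 : 1 - (q - 2) / (2 * q + 2) = (q / 2 + 2) / (q + 1) := by
      field_simp
      ring
    have e2 : (1 - 2 * ((q - 2) / (2 * q + 2))) / 3 = 1 / (q + 1) := by
      field_simp
      ring
    rw [e1, e2] at hdim
    set D := √q * (n : ℝ) ^ ((q / 2 + 2) / (q + 1)) * Real.log n ^ (1 / (q + 1)) with hD
    have hk' : (0 : ℝ) < Module.finrank ℝ V := by exact_mod_cast hk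
    have hD0 : D ≠ 0 := fun h => by
      rw [h, div_zero] at hdim
      linarith
    have hDpos : 0 < D := lt_of_le_of_ne (by positivity) hD0.symm
    have hn2 : 2 ≤ n := by
      by_contra hlt
      obtain rfl : n = 1 := by omega
      refine hD0 ?_
      rw [hD, Nat.cast_one, Real.log_one, Real.zero_rpow (by positivity), mul_zero]
    exact Saturation.exists_space_of_hasDominant hq hk hn
      (Saturation.hasDominant_of_le hq hk hn2 hmn ((le_div_iff₀ hDpos).1 hdim)) rfl
      (by linarith) fun M x =>
        Saturation.cotype_ineq_of_cotypeConst_le hq.le (by linarith) hVΓ x
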